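/- arXiv:1705.10615 — 2 statements merged into one kernel-verified Lean document; each statement's English description precedes it below -/
import Mathlib

section
/- Let R be a Cohen-Macaulay local ring with canonical module ω_R, a a Cohen-Macaulay quasi-Gorenstein ideal, and R̄ = R/a. (1) If M is a finitely generated R-module in the Auslander class A_{ω_R} with a ⊆ ann_R(M) which is self-linked by the ideal a (i.e. M ≅ λ_{R̄} M), then M ⊗_{R̄} ω_{R̄} lies in the Bass class B_{ω_R} and is self-linked by a with respect to ω_{R̄} (i.e. M ⊗_{R̄} ω_{R̄} ≅ λ_{R̄}(ω_{R̄}, M ⊗_{R̄} ω_{R̄})), and Hom_{R̄}(ω_{R̄}, M ⊗_{R̄} ω_{R̄}) ≅ M. (2) Conversely, if N ∈ B_{ω_R} with a ⊆ ann_R(N) is self-linked by a with respect to ω_{R̄}, then Hom_{R̄}(ω_{R̄}, N) lies in A_{ω_R} and is self-linked by the ideal a, and ω_{R̄} ⊗_{R̄} Hom_{R̄}(ω_{R̄}, N) ≅ N. -/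
/- Preliminary definitions for formalizing
   "Linkage of modules with respect to a semidualizing module"
   (Dibaei–Sadeghi). -/

open CategoryTheory

universe u
noncomputable section
namespace Paper

variable (R : Type u) [CommRing R]

/-- `Ext^i_R(M,N)`, realized via Mathlib's derived-functor `Ext` for the
`R`-linear abelian category of `R`-modules. -/
abbrev ExtGrp (M N : Type u) [AddCommGroup M] [Module R M] [AddCommGroup N] [Module R N]
    (i : ℕ) : Type u :=
  ((Ext R (ModuleCat.{u} R) i).obj (Opposite.op (ModuleCat.of R M))).obj (ModuleCat.of R N)

/-- `Tor^R_i(M,N)`. -/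
abbrev TorGrp (M N : Type u) [AddCommGroup M] [Module R M] [AddCommGroup N] [Module R N]
    (i : ℕ) : Type u :=
  ((Tor (ModuleCat.{u} R) i).obj (ModuleCat.of R M)).obj (ModuleCat.of R N)

/-- Local cohomology `H^i_I(M)`. -/
abbrev LocCoh (I : Ideal R) (i : ℕ) (M : Type u) [AddCommGroup M] [Module R M] : Type u :=
  (localCohomology I i).obj (ModuleCat.of R M)

/-- A commutative ring is semiperfect iff it is a finite direct product of
commutative local rings. -/
def IsSemiperfectRing : Prop :=
  ∃ (n : ℕ) (A : Fin n → Type u) (c : ∀ i, CommRing (A i)),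
    (∀ i, letI := c i; IsLocalRing (A i)) ∧
    (letI := c; Nonempty (R ≃+* ((i : Fin n) → A i)))

/-- `C` is a semidualizing `R`-module: `C` is finitely generated, the homothety map
`R → Hom_R(C,C)` is bijective, and `Ext^i_R(C,C) = 0` for all `i > 0`. -/
def IsSemidualizing (C : Type u) [AddCommGroup C] [Module R C] : Prop :=
  Module.Finite R C ∧
  Function.Bijective (LinearMap.lsmul R C) ∧
  ∀ i : ℕ, 0 < i → Subsingleton (ExtGrp R C C i)

/-- A minimal projective presentation `P₁ → P₀ → M → 0` of `M`:
both `P₀ → M` and the induced `P₁ → ker(P₀ → M)` are projective covers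
(surjections from finitely generated projectives with superfluous kernels). -/
structure MinPres (M : Type u) [AddCommGroup M] [Module R M] where
  P₁ : Type u
  P₀ : Type u
  [acg₁ : AddCommGroup P₁]
  [acg₀ : AddCommGroup P₀]
  [mod₁ : Module R P₁]
  [mod₀ : Module R P₀]
  f : P₁ →ₗ[R] P₀
  g : P₀ →ₗ[R] M
  finite₁ : Module.Finite R P₁
  finite₀ : Module.Finite R P₀
  proj₁ : Module.Projective R P₁
  proj₀ : Module.Projective R P₀
  surj : Function.Surjective g
  exact : LinearMap.range f = LinearMap.ker g
  min₀ : ∀ N : Submodule R P₀, N ⊔ LinearMap.ker g = ⊤ → N = ⊤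
  min₁ : ∀ N : Submodule R P₁, N ⊔ LinearMap.ker f = ⊤ → N = ⊤

attribute [instance] MinPres.acg₁ MinPres.acg₀ MinPres.mod₁ MinPres.mod₀

variable {R}

/-- Given a minimal presentation `P₁ --f--> P₀ → X → 0` this is
`Hom(f,C) : Hom_R(P₀,C) → Hom_R(P₁,C)`; its image is `Ω_C Tr_C X` and its
cokernel is the transpose `Tr_C X` of `X` with respect to `C`. -/
def MinPres.homC {X : Type u} [AddCommGroup X] [Module R X]
    (C : Type u) [AddCommGroup C] [Module R C] (pres : MinPres R X) :
    (pres.P₀ →ₗ[R] C) →ₗ[R] (pres.P₁ →ₗ[R] C) :=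
  LinearMap.lcomp R C pres.f

/-- `Tr_C X` computed from a given minimal presentation. -/
def MinPres.trC {X : Type u} [AddCommGroup X] [Module R X]
    (C : Type u) [AddCommGroup C] [Module R C] (pres : MinPres R X) : Type u :=
  (pres.P₁ →ₗ[R] C) ⧸ LinearMap.range (pres.homC C)

instance {X : Type u} [AddCommGroup X] [Module R X] (C : Type u) [AddCommGroup C] [Module R C]
    (pres : MinPres R X) : AddCommGroup (pres.trC C) :=
  inferInstanceAs (AddCommGroup ((pres.P₁ →ₗ[R] C) ⧸ LinearMap.range (pres.homC C)))

instance {X : Type u} [AddCommGroup X] [Module R X] (C : Type u) [AddCommGroup C] [Module R C]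
    (pres : MinPres R X) : Module R (pres.trC C) :=
  inferInstanceAs (Module R ((pres.P₁ →ₗ[R] C) ⧸ LinearMap.range (pres.homC C)))

variable (R)

/-- `N ≅ Ω_C Tr_C X` : `N` is (isomorphic to) the image of `Hom(f,C)` for a
minimal projective presentation `P₁ --f--> P₀ → X → 0` of `X`. -/
def IsOmegaTrC (C : Type u) [AddCommGroup C] [Module R C]
    (X : Type u) [AddCommGroup X] [Module R X]
    (N : Type u) [AddCommGroup N] [Module R N] : Prop :=
  ∃ pres : MinPres R X, Nonempty (N ≃ₗ[R] ↥(LinearMap.range (pres.homC C)))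

/-- `N ≅ λ_R(C,M) = Ω_C Tr_C (Hom_R(C,M))`. -/
def IsLambdaOf (C : Type u) [AddCommGroup C] [Module R C]
    (M : Type u) [AddCommGroup M] [Module R M]
    (N : Type u) [AddCommGroup N] [Module R N] : Prop :=
  IsOmegaTrC R C (C →ₗ[R] M) N

/-- `M` is horizontally linked with respect to `C` : `M ≅ λ_R(C, λ_R(C,M))`. -/
def IsHorizontallyLinked (C : Type u) [AddCommGroup C] [Module R C]
    (M : Type u) [AddCommGroup M] [Module R M] : Prop :=
  ∃ N : ModuleCat.{u} R, IsLambdaOf R C M N ∧ IsLambdaOf R C N M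

/-- `M` is horizontally linked in the sense of Martsinkovsky–Strooker:
`M ≅ λ(λ M)` where `λ = Ω Tr`. -/
def IsHorizontallyLinkedMS (M : Type u) [AddCommGroup M] [Module R M] : Prop :=
  ∃ N : ModuleCat.{u} R, IsOmegaTrC R R M N ∧ IsOmegaTrC R R N M

/-- `underline-Hom_R(M,N) = 0` : every homomorphism `M → N` factors through a
projective module. -/
def StableHomZero (M N : Type u) [AddCommGroup M] [Module R M]
    [AddCommGroup N] [Module R N] : Prop :=
  ∀ φ : M →ₗ[R] N, ∃ P : ModuleCat.{u} R, Module.Projective R P ∧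
    ∃ (α : M →ₗ[R] P) (β : (P : Type u) →ₗ[R] N), β ∘ₗ α = φ

/-- `M` is `C`-stable: `M` has no nonzero direct summand of the form `P ⊗_R C`
with `P` projective. -/
def IsCStable (C M : Type u) [AddCommGroup C] [Module R C]
    [AddCommGroup M] [Module R M] : Prop :=
  ∀ N₁ N₂ : Submodule R M, IsCompl N₁ N₂ →
    ∀ P : ModuleCat.{u} R, Module.Projective R P →
      Nonempty (↥N₁ ≃ₗ[R] TensorProduct R P C) → N₁ = ⊥

/-- `M` is a `C`-syzygy: `M` embeds into a module `P ⊗_R C` with `P` projective. -/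
def IsCSyzygy (C M : Type u) [AddCommGroup C] [Module R C]
    [AddCommGroup M] [Module R M] : Prop :=
  ∃ P : ModuleCat.{u} R, Module.Projective R P ∧
    ∃ ι : M →ₗ[R] TensorProduct R (P : Type u) C, Function.Injective ι

/-- Auxiliary recursion for `n`-th `C`-syzygies. -/
def IsNthCSyzygyAux (C : Type u) [AddCommGroup C] [Module R C] :
    ℕ → ModuleCat.{u} R → Prop
  | 0, _ => True
  | (m+1), M =>
    ∃ P : ModuleCat.{u} R, Module.Projective R P ∧
      ∃ ι : (M : Type u) →ₗ[R] TensorProduct R (P : Type u) C, Function.Injective ι ∧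
        IsNthCSyzygyAux C m
          (ModuleCat.of R (TensorProduct R (P : Type u) C ⧸ LinearMap.range ι))

/-- `M` is an `n`-th `C`-syzygy: there is an exact sequence
`0 → M → C₁ → ⋯ → C_n` with each `C_j` of the form `P_j ⊗_R C`, `P_j` projective. -/
def IsNthCSyzygy (n : ℕ) (C M : Type u) [AddCommGroup C] [Module R C]
    [AddCommGroup M] [Module R M] : Prop :=
  IsNthCSyzygyAux R C n (ModuleCat.of R M)

/-- The biduality map `M → Hom_R(Hom_R(M,C),C)`. -/
def bidualityMap (C M : Type u) [AddCommGroup C] [Module R C]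
    [AddCommGroup M] [Module R M] : M →ₗ[R] ((M →ₗ[R] C) →ₗ[R] C) :=
  (LinearMap.id : (M →ₗ[R] C) →ₗ[R] (M →ₗ[R] C)).flip

/-- `M` has `G_C`-dimension zero. -/
def GCdimZero (C M : Type u) [AddCommGroup C] [Module R C]
    [AddCommGroup M] [Module R M] : Prop :=
  Module.Finite R M ∧
  Function.Bijective (bidualityMap R C M) ∧
  (∀ i : ℕ, 0 < i → Subsingleton (ExtGrp R M C i)) ∧
  (∀ i : ℕ, 0 < i → Subsingleton (ExtGrp R (M →ₗ[R] C) C i))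

/-- `G_C`-dim`_R(M) ≤ n`: there is a resolution of `M` of length `≤ n` by modules of
`G_C`-dimension zero. -/
def GCdimLE (C M : Type u) [AddCommGroup C] [Module R C]
    [AddCommGroup M] [Module R M] (n : ℕ) : Prop :=
  ∃ (G : ℕ → ModuleCat.{u} R) (d : ∀ i : ℕ, (G (i+1) : Type u) →ₗ[R] G i)
    (ε : (G 0 : Type u) →ₗ[R] M),
    Function.Surjective ε ∧
    LinearMap.range (d 0) = LinearMap.ker ε ∧
    (∀ i : ℕ, LinearMap.range (d (i+1)) = LinearMap.ker (d i)) ∧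
    (∀ i : ℕ, GCdimZero R C (G i)) ∧
    (∀ i : ℕ, n < i → Subsingleton (G i))

/-- `G_C`-dim`_R(M) < ∞`. -/
def GCdimFinite (C M : Type u) [AddCommGroup C] [Module R C]
    [AddCommGroup M] [Module R M] : Prop :=
  ∃ n : ℕ, GCdimLE R C M n

/-- The "depth of `I` on `M`" (classical grade): `inf{ i | Ext^i_R(R/I, M) ≠ 0 }`,
as an extended natural number. -/
def edepth (I : Ideal R) (M : Type u) [AddCommGroup M] [Module R M] : ℕ∞ :=
  sInf {n : ℕ∞ | ∃ i : ℕ, n = i ∧ Nontrivial (ExtGrp R (R ⧸ I) M i)}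

/-- The depth of a module over a local ring. -/
def ldepth [IsLocalRing R] (M : Type u) [AddCommGroup M] [Module R M] : ℕ∞ :=
  edepth R (IsLocalRing.maximalIdeal R) M

/-- `depth_{R_p}(M_p)`. -/
def depthAt (p : Ideal R) [p.IsPrime] (M : Type u) [AddCommGroup M] [Module R M] : ℕ∞ :=
  ldepth (Localization.AtPrime p) (LocalizedModule p.primeCompl M)

/-- `depth R_p`. -/
def ringDepthAt (p : Ideal R) [p.IsPrime] : ℕ∞ :=
  ldepth (Localization.AtPrime p) (Localization.AtPrime p)

/-- Serre's condition `(S̃_n)`: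
`depth_{R_p}(M_p) ≥ min{n, depth R_p}` for all primes `p`. -/
def SerreTilde (n : ℕ) (M : Type u) [AddCommGroup M] [Module R M] : Prop :=
  ∀ (p : Ideal R) (_ : p.IsPrime), min (n : ℕ∞) (ringDepthAt R p) ≤ depthAt R p M

/-- Serre's condition `(S_n)`:
`depth_{R_p}(M_p) ≥ min{n, dim R_p}` for all primes `p`. -/
def SerreS (n : ℕ) (M : Type u) [AddCommGroup M] [Module R M] : Prop :=
  ∀ (p : Ideal R) (_ : p.IsPrime),
    min (n : WithBot ℕ∞) (ringKrullDim (Localization.AtPrime p)) ≤ (depthAt R p M : WithBot ℕ∞)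

/-- The dimension of a module: `dim_R(M) = dim (R / ann_R M)`. -/
def moduleDim (M : Type u) [AddCommGroup M] [Module R M] : WithBot ℕ∞ :=
  ringKrullDim (R ⧸ Module.annihilator R M)

/-- A Cohen-Macaulay module over a local ring: `depth_R(M) = dim_R(M)`. -/
def IsCMModule [IsLocalRing R] (M : Type u) [AddCommGroup M] [Module R M] : Prop :=
  (ldepth R M : WithBot ℕ∞) = moduleDim R M

/-- A maximal Cohen-Macaulay module over a local ring: `depth_R(M) = dim R`. -/
def IsMaximalCM [IsLocalRing R] (M : Type u) [AddCommGroup M] [Module R M] : Prop :=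
  (ldepth R M : WithBot ℕ∞) = ringKrullDim R

/-- A Cohen-Macaulay local ring. -/
def IsCMLocalRing : Prop :=
  ∃ _ : IsLocalRing R, (ldepth R R : WithBot ℕ∞) = ringKrullDim R

/-- `C` has finite injective dimension: for some `n`, `Ext^i_R(-,C)` vanishes
for all `i > n`. -/
def HasFiniteInjDim (C : Type u) [AddCommGroup C] [Module R C] : Prop :=
  ∃ n : ℕ, ∀ (M : ModuleCat.{u} R) (i : ℕ), n < i →
    Subsingleton (((Ext R (ModuleCat.{u} R) i).obj (Opposite.op M)).obj (ModuleCat.of R C))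

/-- `ω` is a canonical module of `R`: a semidualizing module of finite injective
dimension. -/
def IsCanonicalModule (ω : Type u) [AddCommGroup ω] [Module R ω] : Prop :=
  IsSemidualizing R ω ∧ HasFiniteInjDim R ω

/-- `Gid_R(M) ≤ n`: there is an exact complex `⋯ → I_1 → I_0 → I_{-1} → ⋯` of
injective modules, which stays exact under `Hom_R(E,-)` for every injective `E`,
with `M ≅ ker(I_0 → I_{-1})` and `I_j = 0` for `j < -n`. -/
def GidLE (M : Type u) [AddCommGroup M] [Module R M] (n : ℕ) : Prop :=
  ∃ (I : ℤ → ModuleCat.{u} R) (d : ∀ i : ℤ, (I (i+1) : Type u) →ₗ[R] I i),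
    (∀ i : ℤ, Module.Injective R (I i)) ∧
    (∀ i : ℤ, LinearMap.range (d (i+1)) = LinearMap.ker (d i)) ∧
    (∀ E : ModuleCat.{u} R, Module.Injective R E →
      ∀ (i : ℤ) (φ : (E : Type u) →ₗ[R] I (i+1)), d i ∘ₗ φ = 0 →
        ∃ ψ : (E : Type u) →ₗ[R] I (i+1+1), d (i+1) ∘ₗ ψ = φ) ∧
    Nonempty (M ≃ₗ[R] ↥(LinearMap.ker (d (-1)))) ∧
    (∀ i : ℤ, i < -(n : ℤ) → Subsingleton (I i))

/-- `M` has finite Gorenstein injective dimension. -/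
def HasFiniteGid (M : Type u) [AddCommGroup M] [Module R M] : Prop :=
  ∃ n : ℕ, GidLE R M n

/-- The evaluation map `C ⊗_R Hom_R(C,M) → M`. -/
def evalMap (C M : Type u) [AddCommGroup C] [Module R C]
    [AddCommGroup M] [Module R M] : TensorProduct R C (C →ₗ[R] M) →ₗ[R] M :=
  TensorProduct.lift ((LinearMap.id : (C →ₗ[R] M) →ₗ[R] (C →ₗ[R] M)).flip)

/-- Membership in the Bass class `B_C`. -/
def MemBass (C M : Type u) [AddCommGroup C] [Module R C]
    [AddCommGroup M] [Module R M] : Prop :=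
  Function.Bijective (evalMap R C M) ∧
  (∀ i : ℕ, 0 < i → Subsingleton (TorGrp R (C →ₗ[R] M) C i)) ∧
  (∀ i : ℕ, 0 < i → Subsingleton (ExtGrp R C M i))

/-- Membership in the Auslander class `A_C`. -/
def MemAus (C M : Type u) [AddCommGroup C] [Module R C]
    [AddCommGroup M] [Module R M] : Prop :=
  Function.Bijective (TensorProduct.mk R M C) ∧
  (∀ i : ℕ, 0 < i → Subsingleton (TorGrp R M C i)) ∧
  (∀ i : ℕ, 0 < i → Subsingleton (ExtGrp R C (TensorProduct R M C) i))

/-- The grade of a module: the common length of maximal `R`-regular sequences in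
`ann_R(M)`, i.e. `inf{ i | Ext^i(R/ann M, R) ≠ 0 }`. -/
def gradeMod (M : Type u) [AddCommGroup M] [Module R M] : ℕ∞ :=
  edepth R (Module.annihilator R M) R

/-- The grade of an ideal `I`, i.e. `grade_R(R/I)`. -/
def gradeIdeal (I : Ideal R) : ℕ∞ :=
  edepth R I R

/-- An unmixed ideal: every associated prime of `R/I` is a minimal prime of `I`. -/
def IsUnmixedIdeal (I : Ideal R) : Prop :=
  ∀ p ∈ associatedPrimes R (R ⧸ I), p ∈ I.minimalPrimes

/-- Equality of the `a`-th Bass number of `R` (over `R`, w.r.t. the maximal ideal `m`)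
and the `b`-th Bass number of `A` (over `A`, w.r.t. the maximal ideal `mA`): both Ext
modules are vector spaces over the corresponding residue fields of one and the same
dimension. -/
def BassNumbersEq (m : Ideal R) (a : ℕ) (A : Type u) [CommRing A] (mA : Ideal A) (b : ℕ) : Prop :=
  ∃ ι : Type u,
    Nonempty (ExtGrp R (R ⧸ m) R a ≃ₗ[R] (ι →₀ (R ⧸ m))) ∧
    Nonempty (ExtGrp A (A ⧸ mA) A b ≃ₗ[A] (ι →₀ (A ⧸ mA)))

/-- A quasi-Gorenstein ideal of a local ring `R`: `G-dim_R(R/a) < ∞` and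
`μ^{i+depth R}_R(R) = μ^{i+depth R/a}_{R/a}(R/a)` for all `i ≥ 0`. -/
def IsQuasiGorensteinIdeal [IsLocalRing R] (a : Ideal R) : Prop :=
  GCdimFinite R R (R ⧸ a) ∧
  ∀ i : ℕ,
    BassNumbersEq R (IsLocalRing.maximalIdeal R) (i + (ldepth R R).toNat)
      (R ⧸ a) (Ideal.map (Ideal.Quotient.mk a) (IsLocalRing.maximalIdeal R))
      (i + (edepth (R ⧸ a) (Ideal.map (Ideal.Quotient.mk a) (IsLocalRing.maximalIdeal R))
        (R ⧸ a)).toNat)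

/-- `E` is an injective hull of `K`: `E` is injective and contains a copy of `K`
as an essential submodule. -/
def IsInjectiveHull (K E : Type u) [AddCommGroup K] [Module R K]
    [AddCommGroup E] [Module R E] : Prop :=
  Module.Injective R E ∧
  ∃ ι : K →ₗ[R] E, Function.Injective ι ∧
    ∀ N : Submodule R E, N ≠ ⊥ → N ⊓ LinearMap.range ι ≠ ⊥

/-- A generalized Cohen-Macaulay module over a local ring: `dim M ≥ 1` and
`H^i_m(M)` has finite length for all `i < dim M`. -/
def IsGeneralizedCM [IsLocalRing R] (M : Type u) [AddCommGroup M] [Module R M] : Prop :=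
  1 ≤ moduleDim R M ∧
  ∀ i : ℕ, (i : WithBot ℕ∞) < moduleDim R M →
    IsFiniteLength R (LocCoh R (IsLocalRing.maximalIdeal R) i M)

end Paper

namespace Paper

section ExtComparison

variable {R : Type u} [CommRing R] {X : ModuleCat.{u} R} (P : ProjectiveResolution X)
  (Y : ModuleCat.{u} R)

open CochainComplex HomComplex in
lemma extMk_eq_zero_imp_of_zero {Y : ModuleCat.{u} R} (f : P.complex.X 0 ⟶ Y) (m : ℕ)
    (hm : 0 + 1 = m) (hf : P.complex.d m 0 ≫ f = 0) (h : P.extMk f m hm hf = 0) : f = 0 := by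
  rw [← P.extEquivCohomologyClass.apply_eq_iff_eq,
    ProjectiveResolution.extEquivCohomologyClass_extMk,
    ProjectiveResolution.extEquivCohomologyClass_zero,
    CohomologyClass.mk_eq_zero_iff] at h
  rw [Cocycle.toSingleMk_mem_coboundaries_iff _ _ _ _ _ 1 (by simp)] at h
  obtain ⟨g, hg⟩ := h
  have : g = 0 := by
    refine Limits.IsZero.eq_of_src ?_ _ _
    exact CochainComplex.isZero_of_isStrictlyLE P.cochainComplex 0 1 (by lia)
  rw [this, Limits.comp_zero] at hg
  rw [← cancel_epi (P.cochainComplexXIso (-((0:ℕ):ℤ)) 0 rfl).hom, ← hg, Limits.comp_zero]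

/-- Cocycles of `Hom(P, Y)` map to Yoneda `Ext` classes. -/
def cocycleToExt (n : ℕ) :
    LinearMap.ker ((P.complex.linearYonedaObj R Y).sc n).g.hom →ₗ[R] Abelian.Ext X Y n where
  toFun f := P.extMk (n := n) (Y := Y) f.1 ((ComplexShape.up ℕ).next n) (by simp) f.2
  map_add' f g := by
    exact (P.add_extMk (n := n) (Y := Y) f.1 g.1 _ _ f.2 g.2).symm
  map_smul' r f := by
    rw [RingHom.id_apply, Abelian.Ext.smul_eq_comp_mk₀]
    refine Eq.trans ?_ (P.extMk_comp_mk₀ (n := n) (Y := Y) f.1 _ _ f.2 (r • 𝟙 Y)).symm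
    have h : (show P.complex.X n ⟶ Y from f.1) ≫ (r • 𝟙 Y) = (r • f).1 := by
      rw [Linear.comp_smul, Category.comp_id]; rfl
    simp only [h]

lemma cocycleToExt_surjective (n : ℕ) : Function.Surjective (cocycleToExt P Y n) := by
  intro α
  obtain ⟨f, hf, h⟩ := P.extMk_surjective α ((ComplexShape.up ℕ).next n) (by simp)
  exact ⟨⟨f, hf⟩, h⟩

lemma ker_cocycleToExt (n : ℕ) : LinearMap.ker (cocycleToExt P Y n) =
    LinearMap.range ((P.complex.linearYonedaObj R Y).sc n).moduleCatToCycles := by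
  ext f
  rw [LinearMap.mem_ker, LinearMap.mem_range]
  rcases n with _ | n
  · constructor
    · intro h
      have := extMk_eq_zero_imp_of_zero P f.1 _ (by simp) f.2 h
      exact ⟨0, by rw [map_zero]; exact Subtype.ext this.symm⟩
    · rintro ⟨g, hg⟩
      have h0 : ((P.complex.linearYonedaObj R Y).sc 0).f = 0 :=
        (P.complex.linearYonedaObj R Y).shape ((ComplexShape.up ℕ).prev 0) 0
          (fun h => Nat.succ_ne_zero _ h)
      have : f = 0 := by
        rw [← hg]
        apply Subtype.ext
        change ((P.complex.linearYonedaObj R Y).sc 0).f.hom g = 0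
        rw [h0]; rfl
      rw [this, map_zero]
  · refine (P.extMk_eq_zero_iff f.1 _ (by simp) f.2 ((ComplexShape.up ℕ).prev (n + 1))
      (by simp)).trans ?_
    exact exists_congr fun g => ⟨fun h => Subtype.ext h, fun h => congrArg Subtype.val h⟩

/-- The derived functor `Ext` agrees with the Yoneda `Ext`, linearly. -/
def extComparison (n : ℕ) :
    (((Ext R (ModuleCat.{u} R) n).obj (Opposite.op X)).obj Y) ≃ₗ[R] Abelian.Ext X Y n :=
  let P := projectiveResolution X
  (P.isoExt n Y).toLinearEquiv ≪≫ₗ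
    ((P.complex.linearYonedaObj R Y).sc n).moduleCatHomologyIso.toLinearEquiv ≪≫ₗ
    Submodule.quotEquivOfEq _ _ (ker_cocycleToExt P Y n).symm ≪≫ₗ
    (cocycleToExt P Y n).quotKerEquivOfSurjective (cocycleToExt_surjective P Y n)

end ExtComparison

section ExtVanishing

/-- A short exact sequence of modules. -/
structure SES {R : Type u} [CommRing R] {A B C : Type u} [AddCommGroup A] [Module R A]
    [AddCommGroup B] [Module R B] [AddCommGroup C] [Module R C]
    (f : A →ₗ[R] B) (g : B →ₗ[R] C) : Prop where
  inj : Function.Injective f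
  surj : Function.Surjective g
  exact : Function.Exact f g

/-- `Ext^i_R(M, N) = 0`, for the Yoneda `Ext`. -/
def ExtVan (R : Type u) [CommRing R] (M N : Type u) [AddCommGroup M] [Module R M]
    [AddCommGroup N] [Module R N] (i : ℕ) : Prop :=
  Subsingleton (Abelian.Ext (ModuleCat.of R M) (ModuleCat.of R N) i)

variable {R : Type u} [CommRing R] {A B C X Y Z : Type u}
  [AddCommGroup A] [Module R A] [AddCommGroup B] [Module R B] [AddCommGroup C] [Module R C]
  [AddCommGroup X] [Module R X] [AddCommGroup Y] [Module R Y] [AddCommGroup Z] [Module R Z]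

lemma subsingleton_extGrp_iff {i : ℕ} : Subsingleton (ExtGrp R X Y i) ↔ ExtVan R X Y i :=
  (extComparison (X := ModuleCat.of R X) (ModuleCat.of R Y) i).toEquiv.subsingleton_congr

lemma extVan_iff {i : ℕ} : ExtVan R X Y i ↔
    ∀ x : Abelian.Ext (ModuleCat.of R X) (ModuleCat.of R Y) i, x = 0 :=
  subsingleton_iff_forall_eq 0

lemma extVan_zero_iff : ExtVan R X Y 0 ↔ ∀ f : X →ₗ[R] Y, f = 0 := by
  rw [← subsingleton_iff_forall_eq]
  exact ((Abelian.Ext.linearEquiv₀ (R := R)).toEquiv.trans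
    ModuleCat.homEquiv).subsingleton_congr

lemma ExtVan.of_proj {i : ℕ} (hi : 0 < i) [Module.Projective R X] : ExtVan R X Y i := by
  have : Projective (ModuleCat.of R X) := (IsProjective.iff_projective X).mp inferInstance
  obtain ⟨j, rfl⟩ := Nat.exists_eq_add_of_le' hi
  exact extVan_iff.mpr fun x => Abelian.Ext.eq_zero_of_projective x

lemma ExtVan.of_inj {i : ℕ} (hi : 0 < i) [Module.Injective R Y] : ExtVan R X Y i := by
  have : Injective (ModuleCat.of R Y) :=
    (Module.injective_iff_injective_object R Y).mp inferInstance
  obtain ⟨j, rfl⟩ := Nat.exists_eq_add_of_le' hi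
  exact extVan_iff.mpr fun x => Abelian.Ext.eq_zero_of_injective x

lemma ExtVan.of_retract_right {i : ℕ} (h : ExtVan R X Y i) (s : Z →ₗ[R] Y) (r : Y →ₗ[R] Z)
    (hrs : r ∘ₗ s = LinearMap.id) : ExtVan R X Z i := by
  refine extVan_iff.mpr fun x => ?_
  have : ModuleCat.ofHom s ≫ ModuleCat.ofHom r = 𝟙 (ModuleCat.of R Z) := by
    rw [← ModuleCat.ofHom_comp, hrs]; rfl
  rw [← x.comp_mk₀_id, ← this, ← Abelian.Ext.mk₀_comp_mk₀,
    ← Abelian.Ext.comp_assoc x _ _ (add_zero i) _ (by lia),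
    extVan_iff.mp h (x.comp _ (add_zero i)), Abelian.Ext.zero_comp]

lemma ExtVan.of_retract_left {i : ℕ} (h : ExtVan R X Y i) (s : Z →ₗ[R] X) (r : X →ₗ[R] Z)
    (hrs : r ∘ₗ s = LinearMap.id) : ExtVan R Z Y i := by
  refine extVan_iff.mpr fun x => ?_
  have : ModuleCat.ofHom s ≫ ModuleCat.ofHom r = 𝟙 (ModuleCat.of R Z) := by
    rw [← ModuleCat.ofHom_comp, hrs]; rfl
  rw [← x.mk₀_id_comp, ← this, ← Abelian.Ext.mk₀_comp_mk₀,
    Abelian.Ext.comp_assoc _ _ x _ (zero_add i) (by lia),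
    extVan_iff.mp h (Abelian.Ext.comp _ x (zero_add i)), Abelian.Ext.comp_zero]

lemma ExtVan.congr_right {i : ℕ} (h : ExtVan R X Y i) (e : Y ≃ₗ[R] Z) : ExtVan R X Z i :=
  h.of_retract_right e.symm.toLinearMap e.toLinearMap (by ext; simp)

lemma ExtVan.congr_left {i : ℕ} (h : ExtVan R X Y i) (e : X ≃ₗ[R] Z) : ExtVan R Z Y i :=
  h.of_retract_left e.symm.toLinearMap e.toLinearMap (by ext; simp)

lemma ExtVan.pi_right {i : ℕ} (h : ExtVan R X Y i) {ι : Type} [Fintype ι] :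
    ExtVan R X (ι → Y) i := by
  classical
  refine extVan_iff.mpr fun x => ?_
  have : ∑ j : ι, (ModuleCat.ofHom (LinearMap.proj (R := R) (φ := fun _ : ι => Y) j)) ≫
      ModuleCat.ofHom (LinearMap.single R (fun _ => Y) j) = 𝟙 (ModuleCat.of R (ι → Y)) := by
    refine ModuleCat.hom_ext (LinearMap.ext fun v => ?_)
    rw [ModuleCat.hom_sum, LinearMap.sum_apply]
    refine funext fun k => ?_
    simp [Finset.sum_apply, Pi.single_apply]
  rw [← x.comp_mk₀_id, ← this, Abelian.Ext.mk₀_sum, Abelian.Ext.comp_sum]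
  refine Finset.sum_eq_zero fun j _ => ?_
  rw [← Abelian.Ext.mk₀_comp_mk₀, ← Abelian.Ext.comp_assoc x _ _ (add_zero i) _ (by lia),
    extVan_iff.mp h (x.comp _ (add_zero i)), Abelian.Ext.zero_comp]

end ExtVanishing

namespace SES

variable {R : Type u} [CommRing R] {A B C X Y : Type u}
  [AddCommGroup A] [Module R A] [AddCommGroup B] [Module R B] [AddCommGroup C] [Module R C]
  [AddCommGroup X] [Module R X] [AddCommGroup Y] [Module R Y]
  {f : A →ₗ[R] B} {g : B →ₗ[R] C} (h : SES f g)

include h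

lemma comp_eq_zero : g ∘ₗ f = 0 := h.exact.linearMap_comp_eq_zero

lemma shortExact : (ShortComplex.mk (ModuleCat.ofHom f) (ModuleCat.ofHom g) (by
    rw [← ModuleCat.ofHom_comp, h.comp_eq_zero]; rfl)).ShortExact where
  exact := (ShortComplex.ShortExact.moduleCat_exact_iff_function_exact _).mpr h.exact
  mono_f := (ModuleCat.mono_iff_injective _).mpr h.inj
  epi_g := (ModuleCat.epi_iff_surjective _).mpr h.surj

lemma van_third_right {i : ℕ} (h2 : ExtVan R X B i) (h1 : ExtVan R X A (i + 1)) :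
    ExtVan R X C i := by
  refine extVan_iff.mpr fun x => ?_
  obtain ⟨y, rfl⟩ := Abelian.Ext.covariant_sequence_exact₃ _ h.shortExact x rfl
    (extVan_iff.mp h1 _)
  rw [extVan_iff.mp h2 y, Abelian.Ext.zero_comp]

lemma van_first_right {i : ℕ} (h3 : ExtVan R X C i) (h2 : ExtVan R X B (i + 1)) :
    ExtVan R X A (i + 1) := by
  refine extVan_iff.mpr fun x => ?_
  obtain ⟨y, rfl⟩ := Abelian.Ext.covariant_sequence_exact₁ _ h.shortExact x
    (extVan_iff.mp h2 _) rfl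
  rw [extVan_iff.mp h3 y, Abelian.Ext.zero_comp]

lemma van_mid_left {i : ℕ} (h3 : ExtVan R C Y i) (h1 : ExtVan R A Y i) : ExtVan R B Y i := by
  refine extVan_iff.mpr fun x => ?_
  obtain ⟨y, rfl⟩ := Abelian.Ext.contravariant_sequence_exact₂ h.shortExact _ x
    (extVan_iff.mp h1 _)
  rw [extVan_iff.mp h3 y, Abelian.Ext.comp_zero]

lemma van_third_left {i : ℕ} (h1 : ExtVan R A Y i) (h2 : ExtVan R B Y (i + 1)) :
    ExtVan R C Y (i + 1) := by
  refine extVan_iff.mpr fun x => ?_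
  obtain ⟨y, rfl⟩ := Abelian.Ext.contravariant_sequence_exact₃ h.shortExact _ x
    (extVan_iff.mp h2 _) (add_comm 1 i)
  rw [extVan_iff.mp h1 y, Abelian.Ext.comp_zero]

lemma van_first_left {i : ℕ} (h2 : ExtVan R B Y i) (h3 : ExtVan R C Y (i + 1)) :
    ExtVan R A Y i := by
  refine extVan_iff.mpr fun x => ?_
  obtain ⟨y, rfl⟩ := Abelian.Ext.contravariant_sequence_exact₁ h.shortExact _ x (add_comm 1 i)
    (extVan_iff.mp h3 _)
  rw [extVan_iff.mp h2 y, Abelian.Ext.comp_zero]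

lemma exists_lift (h1 : ExtVan R X A 1) (φ : X →ₗ[R] C) : ∃ ψ : X →ₗ[R] B, g ∘ₗ ψ = φ := by
  obtain ⟨y, hy⟩ := Abelian.Ext.covariant_sequence_exact₃ _ h.shortExact
    (Abelian.Ext.mk₀ (ModuleCat.ofHom φ)) (zero_add 1) (extVan_iff.mp h1 _)
  obtain ⟨y, rfl⟩ := Abelian.Ext.mk₀_bijective _ _ |>.2 y
  rw [Abelian.Ext.mk₀_comp_mk₀] at hy
  have := (Abelian.Ext.mk₀_bijective _ _).1 hy
  exact ⟨y.hom, congrArg ModuleCat.Hom.hom this⟩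

lemma exists_extend (h3 : ExtVan R C Y 1) (φ : A →ₗ[R] Y) : ∃ ψ : B →ₗ[R] Y, ψ ∘ₗ f = φ := by
  obtain ⟨y, hy⟩ := Abelian.Ext.contravariant_sequence_exact₁ h.shortExact _
    (Abelian.Ext.mk₀ (ModuleCat.ofHom φ)) (add_zero 1) (extVan_iff.mp h3 _)
  obtain ⟨y, rfl⟩ := Abelian.Ext.mk₀_bijective _ _ |>.2 y
  rw [Abelian.Ext.mk₀_comp_mk₀] at hy
  have := (Abelian.Ext.mk₀_bijective _ _).1 hy
  exact ⟨y.hom, congrArg ModuleCat.Hom.hom this⟩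

lemma van_one_of_lift (h2 : ExtVan R X B 1)
    (hl : ∀ φ : X →ₗ[R] C, ∃ ψ : X →ₗ[R] B, g ∘ₗ ψ = φ) : ExtVan R X A 1 := by
  refine extVan_iff.mpr fun x => ?_
  obtain ⟨y, rfl⟩ := Abelian.Ext.covariant_sequence_exact₁ _ h.shortExact x
    (extVan_iff.mp h2 _) (zero_add 1)
  obtain ⟨y, rfl⟩ := Abelian.Ext.mk₀_bijective _ _ |>.2 y
  obtain ⟨ψ, hψ⟩ := hl y.hom
  have : y = ModuleCat.ofHom ψ ≫ ModuleCat.ofHom g := by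
    exact ModuleCat.hom_ext hψ.symm
  rw [this, ← Abelian.Ext.mk₀_comp_mk₀,
    Abelian.Ext.comp_assoc _ _ _ (zero_add 0) (zero_add 1) (by lia)]
  erw [h.shortExact.comp_extClass]
  rw [Abelian.Ext.comp_zero]

lemma van_one_of_extend (h2 : ExtVan R B Y 1)
    (hl : ∀ φ : A →ₗ[R] Y, ∃ ψ : B →ₗ[R] Y, ψ ∘ₗ f = φ) : ExtVan R C Y 1 := by
  refine extVan_iff.mpr fun x => ?_
  obtain ⟨y, rfl⟩ := Abelian.Ext.contravariant_sequence_exact₃ h.shortExact _ x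
    (extVan_iff.mp h2 _) (add_zero 1)
  obtain ⟨y, rfl⟩ := Abelian.Ext.mk₀_bijective _ _ |>.2 y
  obtain ⟨ψ, hψ⟩ := hl y.hom
  have : y = ModuleCat.ofHom f ≫ ModuleCat.ofHom ψ := by
    exact ModuleCat.hom_ext hψ.symm
  rw [this, ← Abelian.Ext.mk₀_comp_mk₀,
    ← Abelian.Ext.comp_assoc _ _ _ (add_zero 1) (zero_add 0) (by lia)]
  erw [h.shortExact.extClass_comp]
  rw [Abelian.Ext.zero_comp]

end SES

section Faithful

variable {R : Type u} [CommRing R] [IsNoetherianRing R] {ω L : Type u}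
  [AddCommGroup ω] [Module R ω] [Module.Finite R ω] [AddCommGroup L] [Module R L]

lemma subsingleton_of_hom_eq_zero (hω : Module.annihilator R ω = ⊥)
    (h : ∀ f : ω →ₗ[R] L, f = 0) : Subsingleton L := by
  refine subsingleton_of_forall_eq 0 fun x => ?_
  have h1 : Subsingleton (ω →ₗ[R] Submodule.span R {x}) := by
    refine subsingleton_of_forall_eq 0 fun f => ?_
    have := h ((Submodule.span R {x}).subtype ∘ₗ f)
    ext w
    exact LinearMap.congr_fun this w
  obtain ⟨r, hr, hreg⟩ := IsSMulRegular.subsingleton_linearMap_iff.mp h1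
  rw [hω, Ideal.mem_bot] at hr
  subst hr
  have hx : (⟨x, Submodule.mem_span_singleton_self x⟩ : Submodule.span R {x}) = 0 :=
    hreg (by simp)
  exact congrArg Subtype.val hx

lemma subsingleton_of_subsingleton_tensorProduct (hω : Module.annihilator R ω = ⊥)
    (h : ∀ t : TensorProduct R ω L, t = 0) : Subsingleton L := by
  have h1 : Subsingleton (CharacterModule L) := by
    refine subsingleton_of_hom_eq_zero hω fun f => ?_
    ext w l
    have : w ⊗ₜ[R] l = 0 := h _
    have h2 := congrArg (CharacterModule.homEquiv (R := R) f) this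
    exact h2.trans (map_zero _)
  refine subsingleton_of_forall_eq 0 fun x => CharacterModule.eq_zero_of_character_apply fun c => ?_
  rw [Subsingleton.elim c 0]; rfl

end Faithful

namespace SES

variable {R : Type u} [CommRing R] {A B C : Type u}
  [AddCommGroup A] [Module R A] [AddCommGroup B] [Module R B] [AddCommGroup C] [Module R C]
  {f : A →ₗ[R] B} {g : B →ₗ[R] C}

lemma mkQ (K : Submodule R B) : SES K.subtype K.mkQ :=
  ⟨K.injective_subtype, K.mkQ_surjective, LinearMap.exact_subtype_mkQ K⟩

lemma ker_subtype (hg : Function.Surjective g) : SES (LinearMap.ker g).subtype g :=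
  ⟨Submodule.injective_subtype _, hg, LinearMap.exact_subtype_ker_map g⟩

variable (h : SES f g)
include h

/-- Maps killed by `g` factor through `f`. -/
lemma exists_factor {X : Type u} [AddCommGroup X] [Module R X] (φ : X →ₗ[R] B)
    (hφ : g ∘ₗ φ = 0) : ∃ ψ : X →ₗ[R] A, f ∘ₗ ψ = φ := by
  have hr : ∀ x, φ x ∈ LinearMap.range f := fun x => (h.exact _).mp (LinearMap.congr_fun hφ x)
  refine ⟨(LinearEquiv.ofInjective f h.inj).symm.toLinearMap ∘ₗ φ.codRestrict _ hr, ?_⟩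
  ext x
  exact congrArg Subtype.val ((LinearEquiv.ofInjective f h.inj).apply_symm_apply ⟨φ x, hr x⟩)

/-- Maps vanishing on `f` descend along `g`. -/
lemma exists_desc {X : Type u} [AddCommGroup X] [Module R X] (φ : B →ₗ[R] X)
    (hφ : φ ∘ₗ f = 0) : ∃ ψ : C →ₗ[R] X, ψ ∘ₗ g = φ := by
  have hk : LinearMap.ker g ≤ LinearMap.ker φ := by
    intro b hb
    obtain ⟨a, rfl⟩ := (h.exact _).mp hb
    exact LinearMap.congr_fun hφ a
  refine ⟨(LinearMap.ker g).liftQ φ hk ∘ₗ (g.quotKerEquivOfSurjective h.surj).symm.toLinearMap, ?_⟩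
  ext b
  have : (g.quotKerEquivOfSurjective h.surj).symm (g b) = Submodule.Quotient.mk b := by
    rw [LinearEquiv.symm_apply_eq]; rfl
  simp [this]

lemma compRight {X : Type u} [AddCommGroup X] [Module R X]
    (hl : ∀ φ : X →ₗ[R] C, ∃ ψ : X →ₗ[R] B, g ∘ₗ ψ = φ) :
    SES (f.compRight R (M := X)) (g.compRight R (M := X)) where
  inj := fun φ ψ hφ => LinearMap.ext fun x => h.inj (LinearMap.congr_fun hφ x)
  surj := hl
  exact := fun φ => ⟨fun hφ => h.exists_factor φ hφ, by
    rintro ⟨ψ, rfl⟩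
    ext x
    exact LinearMap.congr_fun h.comp_eq_zero (ψ x)⟩

lemma lcomp {X : Type u} [AddCommGroup X] [Module R X]
    (hl : ∀ φ : A →ₗ[R] X, ∃ ψ : B →ₗ[R] X, ψ ∘ₗ f = φ) :
    SES (g.lcomp R X) (f.lcomp R X) where
  inj := fun φ ψ hφ => LinearMap.ext fun c => by
    obtain ⟨b, rfl⟩ := h.surj c
    exact LinearMap.congr_fun hφ b
  surj := hl
  exact := fun φ => ⟨fun hφ => h.exists_desc φ hφ, by
    rintro ⟨ψ, rfl⟩
    ext a
    change ψ (g (f a)) = 0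
    rw [show g (f a) = 0 from LinearMap.congr_fun h.comp_eq_zero a, map_zero]⟩

lemma dual : SES (CharacterModule.dual g) (CharacterModule.dual f) where
  inj := CharacterModule.dual_injective_of_surjective g h.surj
  surj := CharacterModule.dual_surjective_of_injective f h.inj
  exact := fun φ => ⟨fun hφ => by
    refine ⟨AddMonoidHom.liftOfSurjective g.toAddMonoidHom h.surj ⟨φ, ?_⟩, ?_⟩
    · intro b hb
      obtain ⟨a, rfl⟩ := (h.exact _).mp hb
      exact DFunLike.congr_fun hφ a
    · ext b
      exact AddMonoidHom.liftOfRightInverse_comp_apply g.toAddMonoidHom _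
        (Function.rightInverse_surjInv h.surj) ⟨φ, _⟩ b, by
    rintro ⟨ψ, rfl⟩
    ext a
    change ψ (g (f a)) = 0
    rw [show g (f a) = 0 from LinearMap.congr_fun h.comp_eq_zero a, map_zero]⟩

end SES

section Bass

variable {R : Type u} [CommRing R] {ω X Y I Z : Type u} [AddCommGroup ω] [Module R ω]
  [AddCommGroup X] [Module R X] [AddCommGroup Y] [Module R Y]
  [AddCommGroup I] [Module R I] [AddCommGroup Z] [Module R Z]

lemma evalMap_naturality (g : X →ₗ[R] Y) (t : TensorProduct R ω (ω →ₗ[R] X)) :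
    evalMap R ω Y ((g.compRight R (M := ω)).lTensor ω t) = g (evalMap R ω X t) := by
  have : evalMap R ω Y ∘ₗ (g.compRight R (M := ω)).lTensor ω = g ∘ₗ evalMap R ω X := by
    ext w φ
    simp [evalMap]
  exact LinearMap.congr_fun this t

lemma evalMap_bijective_congr (e : X ≃ₗ[R] Y) (h : Function.Bijective (evalMap R ω X)) :
    Function.Bijective (evalMap R ω Y) := by
  have h1 : ⇑(e.symm.toLinearMap) ∘ evalMap R ω Y =
      evalMap R ω X ∘ (LinearEquiv.congrRight e.symm (M := ω)).lTensor ω :=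
    funext fun t => (evalMap_naturality e.symm.toLinearMap t).symm
  have h2 := h.comp ((LinearEquiv.congrRight e.symm (M := ω)).lTensor ω).bijective
  rw [← h1] at h2
  exact (Function.Bijective.of_comp_iff' e.symm.bijective _).mp h2

variable (R ω X) in
/-- A substitute for the Bass class in which the vanishing of `Tor` is expressed through
character modules. -/
def BassLike : Prop :=
  Function.Bijective (evalMap R ω X) ∧
    ∀ i, 0 < i → ExtVan R ω (CharacterModule (ω →ₗ[R] X)) i

variable {f : Y →ₗ[R] I} {g : I →ₗ[R] Z}

lemma BassLike.of_ses [IsNoetherianRing R] [Module.Finite R ω]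
    (hω : Module.annihilator R ω = ⊥) (h : SES f g)
    (hI : BassLike R ω I) (hZ : BassLike R ω Z) : BassLike R ω Y := by
  set F := f.compRight R (M := ω)
  set G := g.compRight R (M := ω)
  have hG : Function.Surjective G := by
    have : Subsingleton ((ω →ₗ[R] Z) ⧸ LinearMap.range G) := by
      refine subsingleton_of_subsingleton_tensorProduct hω fun t => ?_
      obtain ⟨t, rfl⟩ := LinearMap.lTensor_surjective ω (LinearMap.range G).mkQ_surjective t
      obtain ⟨x, hx⟩ := h.surj (evalMap R ω Z t)
      obtain ⟨s, rfl⟩ := hI.1.2 x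
      rw [← evalMap_naturality] at hx
      rw [← hZ.1.1 hx, ← LinearMap.comp_apply, ← LinearMap.lTensor_comp,
        LinearMap.range_mkQ_comp]
      simp
    exact LinearMap.range_eq_top.mp (Submodule.Quotient.subsingleton_iff.mp this)
  have hV : SES F G := h.compRight hG
  have hF : Function.Injective (F.lTensor ω) := by
    refine CharacterModule.dual_surjective_iff_injective.mp fun c => ?_
    obtain ⟨φ, rfl⟩ := (CharacterModule.homEquiv (R := R)).surjective c
    obtain ⟨ψ, hψ⟩ := hV.dual.exists_lift (hZ.2 1 one_pos) φ
    refine ⟨CharacterModule.homEquiv ψ, ?_⟩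
    ext t
    induction t with
    | zero => rw [map_zero, map_zero]
    | add x y hx hy => rw [map_add, map_add, hx, hy]
    | tmul w l => exact DFunLike.congr_fun (LinearMap.congr_fun hψ w) l
  refine ⟨⟨?_, ?_⟩, fun i hi => hV.dual.van_third_right (hI.2 i hi) (hZ.2 _ i.succ_pos)⟩
  · refine (injective_iff_map_eq_zero _).mpr fun t ht => ?_
    have := evalMap_naturality f t
    rw [ht, map_zero] at this
    exact hF ((hI.1.1 (this.trans (map_zero _).symm)).trans (map_zero _).symm)
  · intro y
    obtain ⟨s, hs⟩ := hI.1.2 (f y)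
    have h1 := evalMap_naturality g s
    rw [hs, show g (f y) = 0 from LinearMap.congr_fun h.comp_eq_zero y] at h1
    have h2 : G.lTensor ω s = 0 := hZ.1.1 (h1.trans (map_zero _).symm)
    obtain ⟨t, rfl⟩ := (lTensor_exact ω hV.exact hV.surj s).mp h2
    refine ⟨t, h.inj ?_⟩
    rw [← evalMap_naturality]
    exact hs

lemma evalMap_surjective_of_ses (h : SES f g) (hI : Function.Surjective (evalMap R ω I)) :
    Function.Surjective (evalMap R ω Z) := by
  intro z
  obtain ⟨x, rfl⟩ := h.surj z
  obtain ⟨s, rfl⟩ := hI x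
  exact ⟨_, evalMap_naturality g s⟩

lemma evalMap_injective_of_ses (h : SES f g) (hl : Function.Surjective (g.compRight R (M := ω)))
    (hI : Function.Injective (evalMap R ω I)) (hY : Function.Surjective (evalMap R ω Y)) :
    Function.Injective (evalMap R ω Z) := by
  refine (injective_iff_map_eq_zero _).mpr fun t ht => ?_
  obtain ⟨s, rfl⟩ := LinearMap.lTensor_surjective ω hl t
  rw [evalMap_naturality] at ht
  obtain ⟨y, hy⟩ := (h.exact _).mp ht
  obtain ⟨r, rfl⟩ := hY y
  rw [← evalMap_naturality] at hy
  rw [← hI hy, ← LinearMap.comp_apply, ← LinearMap.lTensor_comp]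
  have := (h.compRight hl).comp_eq_zero
  rw [this]; simp

end Bass

section BassRetract

variable {R : Type u} [CommRing R] {ω X Y : Type u} [AddCommGroup ω] [Module R ω]
  [AddCommGroup X] [Module R X] [AddCommGroup Y] [Module R Y]

lemma BassLike.of_retract (h : BassLike R ω Y) (s : X →ₗ[R] Y) (r : Y →ₗ[R] X)
    (hrs : r ∘ₗ s = LinearMap.id) : BassLike R ω X := by
  have hrs' : (r.compRight R (M := ω)) ∘ₗ (s.compRight R (M := ω)) = LinearMap.id := by
    ext φ w
    exact LinearMap.congr_fun hrs (φ w)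
  refine ⟨⟨fun t t' ht => ?_, fun x => ?_⟩, fun i hi => (h.2 i hi).of_retract_right
    (CharacterModule.dual (r.compRight R)) (CharacterModule.dual (s.compRight R)) ?_⟩
  · have h1 : (s.compRight R (M := ω)).lTensor ω t = (s.compRight R (M := ω)).lTensor ω t' :=
      h.1.1 (by rw [evalMap_naturality, evalMap_naturality, ht])
    have h2 := congrArg ((r.compRight R (M := ω)).lTensor ω) h1
    simpa only [← LinearMap.comp_apply, ← LinearMap.lTensor_comp, hrs', LinearMap.lTensor_id,
      LinearMap.id_apply] using h2
  · obtain ⟨t, ht⟩ := h.1.2 (s x)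
    refine ⟨(r.compRight R (M := ω)).lTensor ω t, ?_⟩
    rw [evalMap_naturality, ht]
    exact LinearMap.congr_fun hrs x
  · rw [← CharacterModule.dual_comp, hrs']
    rfl

lemma BassLike.congr (h : BassLike R ω Y) (e : Y ≃ₗ[R] X) : BassLike R ω X :=
  h.of_retract e.symm.toLinearMap e.toLinearMap (by ext; simp)

lemma BassLike.of_subsingleton [Subsingleton X] : BassLike R ω X := by
  have h : Subsingleton (CharacterModule (ω →ₗ[R] X)) :=
    subsingleton_of_forall_eq 0 fun c => by
      ext φ
      rw [Subsingleton.elim φ 0, map_zero, map_zero]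
  refine ⟨⟨fun t t' _ => ?_, fun x => ⟨0, Subsingleton.elim _ _⟩⟩, fun i hi => ?_⟩
  · have h1 : ∀ t : TensorProduct R ω (ω →ₗ[R] X), t = 0 := fun t => by
      induction t with
      | zero => rfl
      | add x y hx hy => rw [hx, hy, add_zero]
      | tmul w φ => rw [Subsingleton.elim φ 0, TensorProduct.tmul_zero]
    rw [h1 t, h1 t']
  · have : Module.Injective R (CharacterModule (ω →ₗ[R] X)) :=
      ⟨fun _ _ _ _ _ _ _ _ _ => ⟨0, fun _ => Subsingleton.elim _ _⟩⟩
    exact ExtVan.of_inj hi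

end BassRetract

section TensorEvaluation

variable {R : Type u} [CommRing R] {F F' Y J : Type u} [AddCommGroup F] [Module R F]
  [AddCommGroup F'] [Module R F']
  [AddCommGroup Y] [Module R Y] [AddCommGroup J] [Module R J]

variable (R F Y J) in
/-- The tensor evaluation map `F ⊗ Hom(Y, J) → Hom(Hom(F, Y), J)`. -/
def tensorEval : TensorProduct R F (Y →ₗ[R] J) →ₗ[R] ((F →ₗ[R] Y) →ₗ[R] J) :=
  TensorProduct.lift <| LinearMap.mk₂ R
    (fun w α => α ∘ₗ (LinearMap.id : (F →ₗ[R] Y) →ₗ[R] (F →ₗ[R] Y)).flip w)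
    (fun _ _ _ => by ext; simp) (fun _ _ _ => by ext; simp)
    (fun _ _ _ => by ext; simp) (fun _ _ _ => by ext; simp)

@[simp] lemma tensorEval_tmul (w : F) (α : Y →ₗ[R] J) (z : F →ₗ[R] Y) :
    tensorEval R F Y J (w ⊗ₜ α) z = α (z w) := rfl

lemma tensorEval_naturality (f : F →ₗ[R] F') (t : TensorProduct R F (Y →ₗ[R] J)) :
    tensorEval R F' Y J (f.rTensor _ t) = tensorEval R F Y J t ∘ₗ f.lcomp R Y := by
  induction t with
  | zero => simp
  | add x y hx hy => rw [map_add, map_add, map_add, hx, hy]; rfl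
  | tmul w α => rfl

lemma tensorEval_pi_bijective (n : ℕ) :
    Function.Bijective (tensorEval R (Fin n → R) Y J) := by
  classical
  let inc (i : Fin n) : Y →ₗ[R] ((Fin n → R) →ₗ[R] Y) :=
    LinearMap.smulRightₗ (LinearMap.proj i)
  have hinc (i : Fin n) (y : Y) (x : Fin n → R) : inc i y x = x i • y := rfl
  constructor
  · let inv : ((((Fin n → R) →ₗ[R] Y) →ₗ[R] J)) →ₗ[R] TensorProduct R (Fin n → R) (Y →ₗ[R] J) :=
      ∑ i, (TensorProduct.mk R _ _ (Pi.single i 1)) ∘ₗ (inc i).lcomp R J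
    have : inv ∘ₗ tensorEval R (Fin n → R) Y J = LinearMap.id := by
      refine TensorProduct.ext' fun x α => ?_
      have h1 (i : Fin n) : (inc i).lcomp R J (tensorEval R _ Y J (x ⊗ₜ α)) = x i • α := by
        ext y; simp [hinc]
      simp only [LinearMap.comp_apply, inv, LinearMap.sum_apply, h1, TensorProduct.mk_apply,
        LinearMap.id_apply, ← TensorProduct.smul_tmul]
      rw [← TensorProduct.sum_tmul]
      congr 1
      ext j
      simp [Finset.sum_apply, Pi.single_apply]
    exact Function.LeftInverse.injective (g := inv) fun t => LinearMap.congr_fun this t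
  · intro Λ
    refine ⟨∑ i, (Pi.single i 1 : Fin n → R) ⊗ₜ (Λ ∘ₗ inc i), ?_⟩
    ext z
    rw [map_sum, LinearMap.sum_apply]
    simp only [tensorEval_tmul, LinearMap.comp_apply]
    rw [← map_sum]
    congr 1
    refine LinearMap.pi_ext' fun i => LinearMap.ext_ring ?_
    simp [hinc, Pi.single_apply]

variable [Module.Injective R J]

lemma exists_extend_of_injective {A B : Type u} [AddCommGroup A] [Module R A]
    [AddCommGroup B] [Module R B] {f : A →ₗ[R] B} (hf : Function.Injective f) (φ : A →ₗ[R] J) :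
    ∃ ψ : B →ₗ[R] J, ψ ∘ₗ f = φ := by
  obtain ⟨ψ, h⟩ := Module.Injective.out f hf φ
  exact ⟨ψ, LinearMap.ext h⟩

lemma tensorEval_surjective [Module.Finite R F] :
    Function.Surjective (tensorEval R F Y J) := by
  obtain ⟨n, p, hp⟩ := Module.Finite.exists_fin' R F
  intro Λ
  obtain ⟨Λ', h⟩ := exists_extend_of_injective (f := p.lcomp R Y)
    (fun a b hab => LinearMap.ext fun x => by
      obtain ⟨y, rfl⟩ := hp x
      exact LinearMap.congr_fun hab y) Λ
  obtain ⟨t, rfl⟩ := (tensorEval_pi_bijective n).2 Λ'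
  exact ⟨p.rTensor _ t, (tensorEval_naturality p t).trans h⟩

lemma tensorEval_bijective [IsNoetherianRing R] [Module.Finite R F] :
    Function.Bijective (tensorEval R F Y J) := by
  refine ⟨(injective_iff_map_eq_zero _).mpr fun t ht => ?_, tensorEval_surjective⟩
  obtain ⟨n, p, hp⟩ := Module.Finite.exists_fin' R F
  have h := SES.ker_subtype hp
  obtain ⟨s, rfl⟩ := LinearMap.rTensor_surjective _ hp t
  rw [tensorEval_naturality] at ht
  let q := (LinearMap.ker p).subtype.lcomp R Y
  obtain ⟨Λ, hΛ⟩ := (SES.ker_subtype (g := q.rangeRestrict) q.surjective_rangeRestrict).exists_desc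
    (tensorEval R _ Y J s) (by
      ext ⟨z, hz⟩
      obtain ⟨z', rfl⟩ := h.exists_desc z (congrArg Subtype.val hz)
      exact LinearMap.congr_fun ht z')
  obtain ⟨Λ', hΛ'⟩ := exists_extend_of_injective
    (f := (LinearMap.range q).subtype) (Submodule.injective_subtype _) Λ
  obtain ⟨u, rfl⟩ := tensorEval_surjective Λ'
  have h1 : (LinearMap.ker p).subtype.rTensor _ u = s := by
    refine (tensorEval_pi_bijective n).1 ?_
    rw [tensorEval_naturality, ← hΛ, ← hΛ']
    rfl
  rw [← h1, ← LinearMap.comp_apply, ← LinearMap.rTensor_comp, h.comp_eq_zero]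
  simp

lemma ExtVan.dual_hom [IsNoetherianRing R] (i : ℕ) : ∀ (F : Type u) [AddCommGroup F] [Module R F]
    [Module.Finite R F] (_ : ∀ j, 0 < j → ExtVan R F Y j),
    ExtVan R F (CharacterModule (Y →ₗ[R] J)) (i + 1) := by
  induction i with
  | zero =>
    intro F _ _ _ hF
    obtain ⟨n, p, hp⟩ := Module.Finite.exists_fin' R F
    have h := SES.ker_subtype hp
    refine h.van_one_of_extend (ExtVan.of_proj one_pos) ?_
    refine (rTensor_injective_iff_lcomp_surjective).mp ?_
    refine (injective_iff_map_eq_zero _).mpr fun t ht => ?_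
    refine tensorEval_bijective.1 ?_
    rw [map_zero]
    ext z
    obtain ⟨z, rfl⟩ := h.exists_extend (hF 1 one_pos) z
    have := tensorEval_naturality (LinearMap.ker p).subtype t
    rw [ht, map_zero] at this
    exact (LinearMap.congr_fun this z).symm
  | succ i ih =>
    intro F _ _ _ hF
    obtain ⟨n, p, hp⟩ := Module.Finite.exists_fin' R F
    have h := SES.ker_subtype hp
    exact h.van_third_left (ih _ fun j hj => h.van_first_left (ExtVan.of_proj hj) (hF _ j.succ_pos))
      (ExtVan.of_proj (by omega))

lemma BassLike.hom_injective [IsNoetherianRing R] {ω : Type u} [AddCommGroup ω] [Module R ω]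
    [Module.Finite R ω] (hev : Function.Bijective (evalMap R ω Y))
    (hY : ∀ i, 0 < i → ExtVan R ω Y i) : BassLike R ω ((ω →ₗ[R] Y) →ₗ[R] J) := by
  let e : (Y →ₗ[R] J) ≃ₗ[R] (ω →ₗ[R] ((ω →ₗ[R] Y) →ₗ[R] J)) :=
    (LinearEquiv.congrLeft J R (LinearEquiv.ofBijective _ hev).symm).trans
      (TensorProduct.lift.equiv (.id R) ω (ω →ₗ[R] Y) J).symm
  have he : evalMap R ω ((ω →ₗ[R] Y) →ₗ[R] J) ∘ₗ e.toLinearMap.lTensor ω =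
      tensorEval R ω Y J := by
    ext w α z
    simp [e, evalMap]
  refine ⟨?_, fun i hi => ?_⟩
  · have h1 : Function.Bijective (evalMap R ω ((ω →ₗ[R] Y) →ₗ[R] J) ∘ (e.lTensor ω)) := by
      have := tensorEval_bijective (R := R) (F := ω) (Y := Y) (J := J)
      rw [← he] at this
      exact this
    exact (Function.Bijective.of_comp_iff _ (e.lTensor ω).bijective).mp h1
  · obtain ⟨i, rfl⟩ := Nat.exists_eq_succ_of_ne_zero hi.ne'
    exact (ExtVan.dual_hom (J := J) i ω hY).congr_right (CharacterModule.congr e)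

end TensorEvaluation

section Reflexive

variable {R : Type u} [CommRing R]

lemma SES.congr {A B C A' B' C' : Type u} [AddCommGroup A] [Module R A] [AddCommGroup B]
    [Module R B] [AddCommGroup C] [Module R C] [AddCommGroup A'] [Module R A'] [AddCommGroup B']
    [Module R B'] [AddCommGroup C'] [Module R C']
    {f : A →ₗ[R] B} {g : B →ₗ[R] C} (h : SES f g)
    (a : A' ≃ₗ[R] A) (b : B ≃ₗ[R] B') (c : C ≃ₗ[R] C') :
    SES (b.toLinearMap ∘ₗ f ∘ₗ a.toLinearMap) (c.toLinearMap ∘ₗ g ∘ₗ b.symm.toLinearMap) where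
  inj := b.injective.comp (h.inj.comp a.injective)
  surj := c.surjective.comp (h.surj.comp b.symm.surjective)
  exact := fun x => by
    obtain ⟨x, rfl⟩ := b.surjective x
    simp only [LinearMap.comp_apply, LinearEquiv.coe_coe, LinearEquiv.symm_apply_apply,
      LinearEquiv.map_eq_zero_iff, h.exact x]
    exact ⟨fun ⟨y, hy⟩ => ⟨a.symm y, by simp [hy]⟩, fun ⟨y, hy⟩ => ⟨a y, b.injective hy⟩⟩

/-- The isomorphism `Hom(H, R) ≅ Hom(ω, Hom(H, ω))` induced by an isomorphism `R ≅ Hom(ω, ω)`. -/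
def homSemiEquiv {ω : Type u} [AddCommGroup ω] [Module R ω]
    (h : Function.Bijective (LinearMap.lsmul R ω)) (H : Type u) [AddCommGroup H] [Module R H] :
    (H →ₗ[R] R) ≃ₗ[R] (ω →ₗ[R] (H →ₗ[R] ω)) :=
  (LinearEquiv.congrRight (LinearEquiv.ofBijective
    (LinearMap.lsmul R ω : R →ₗ[R] (ω →ₗ[R] ω)) h)).trans LinearMap.lflip

@[simp] lemma homSemiEquiv_apply {ω : Type u} [AddCommGroup ω] [Module R ω]
    (h : Function.Bijective (LinearMap.lsmul R ω)) {H : Type u} [AddCommGroup H] [Module R H]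
    (r : H →ₗ[R] R) (w : ω) (x : H) : homSemiEquiv h H r w x = r x • w := rfl

lemma evalMap_hom_bijective {ω : Type u} [AddCommGroup ω] [Module R ω]
    (h : Function.Bijective (LinearMap.lsmul R ω)) (P : Type u) [AddCommGroup P] [Module R P]
    [Module.Finite R P] [Module.Projective R P] :
    Function.Bijective (evalMap R ω (P →ₗ[R] ω)) := by
  have h1 : evalMap R ω (P →ₗ[R] ω) ∘ₗ (homSemiEquiv h P).toLinearMap.lTensor ω ∘ₗ
      (TensorProduct.comm R (Module.Dual R P) ω).toLinearMap = dualTensorHom R P ω := by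
    ext r w x
    simp [evalMap]
  have h2 : Function.Bijective (dualTensorHom R P ω) := dualTensorHom_bijective
  rw [← h1] at h2
  exact (Function.Bijective.of_comp_iff _ (((TensorProduct.comm R (Module.Dual R P) ω).trans
    ((homSemiEquiv h P).lTensor ω)).bijective)).mp h2

variable (R) in
/-- Totally reflexive modules. -/
structure TotRefl (H : Type u) [AddCommGroup H] [Module R H] : Prop where
  finite : Module.Finite R H
  bidual : Function.Bijective (bidualityMap R R H)
  ext : ∀ i, 0 < i → ExtVan R H R i
  ext_dual : ∀ i, 0 < i → ExtVan R (H →ₗ[R] R) R i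

lemma GCdimZero.totRefl {H : Type u} [AddCommGroup H] [Module R H] (h : GCdimZero R R H) :
    TotRefl R H :=
  ⟨h.1, h.2.1, fun i hi => subsingleton_extGrp_iff.mp (h.2.2.1 i hi),
    fun i hi => subsingleton_extGrp_iff.mp (h.2.2.2 i hi)⟩

namespace TotRefl

variable {H : Type u} [AddCommGroup H] [Module R H]

/-- Biduality as an equivalence. -/
def equiv (h : TotRefl R H) : H ≃ₗ[R] ((H →ₗ[R] R) →ₗ[R] R) :=
  LinearEquiv.ofBijective _ h.bidual

lemma dual [IsNoetherianRing R] (h : TotRefl R H) : TotRefl R (H →ₗ[R] R) where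
  finite := by have := h.finite; infer_instance
  bidual := by
    have h1 : (LinearEquiv.congrLeft R R h.equiv.symm).toLinearMap ∘ₗ
        bidualityMap R R (H →ₗ[R] R) = LinearMap.id := by
      ext φ x
      rfl
    have h2 := Function.bijective_id (α := H →ₗ[R] R)
    rw [← LinearMap.id_coe (R := R), ← h1, LinearMap.coe_comp] at h2
    exact (Function.Bijective.of_comp_iff' (LinearEquiv.bijective
      (LinearEquiv.congrLeft R R h.equiv.symm)) _).mp h2
  ext := h.ext_dual
  ext_dual := fun i hi => (h.ext i hi).congr_left h.equiv

lemma syzygy [IsNoetherianRing R] (h : TotRefl R H) {n : ℕ} {K : Type u} [AddCommGroup K]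
    [Module R K]
    {f : K →ₗ[R] (Fin n → R)} {g : (Fin n → R) →ₗ[R] H} (hs : SES f g) : TotRefl R K where
  finite := Module.Finite.of_injective f hs.inj
  ext := fun i hi => hs.van_first_left (ExtVan.of_proj hi) (h.ext _ i.succ_pos)
  ext_dual := fun i hi => by
    have hd := hs.lcomp (X := R) (hs.exists_extend (h.ext 1 one_pos))
    obtain ⟨i, rfl⟩ := Nat.exists_eq_succ_of_ne_zero hi.ne'
    cases i with
    | zero =>
      refine hd.van_one_of_extend (ExtVan.of_proj one_pos) fun φ => ?_
      obtain ⟨x, rfl⟩ := h.bidual.2 φ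
      obtain ⟨y, rfl⟩ := hs.surj x
      exact ⟨bidualityMap R R _ y, rfl⟩
    | succ i => exact hd.van_third_left (h.ext_dual _ i.succ_pos) (ExtVan.of_proj (by omega))
  bidual := by
    have hd := hs.lcomp (X := R) (hs.exists_extend (h.ext 1 one_pos))
    have hdd := hd.lcomp (X := R) fun φ => by
      obtain ⟨x, rfl⟩ := h.bidual.2 φ
      obtain ⟨y, rfl⟩ := hs.surj x
      exact ⟨bidualityMap R R _ y, rfl⟩
    constructor
    · refine (injective_iff_map_eq_zero _).mpr fun k hk => hs.inj ?_
      rw [map_zero]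
      ext j
      exact LinearMap.congr_fun hk (LinearMap.proj j ∘ₗ f)
    · intro ξ
      obtain ⟨x, hx⟩ : ∃ x, bidualityMap R R (Fin n → R) x = (f.lcomp R R).lcomp R R ξ :=
        (Module.bijective_dual_eval R (Fin n → R)).2 _
      have h1 : bidualityMap R R H (g x) = 0 := by
        have := LinearMap.congr_fun hdd.comp_eq_zero ξ
        rw [LinearMap.comp_apply, ← hx] at this
        exact this
      obtain ⟨k, rfl⟩ := (hs.exact x).mp (h.bidual.1 (h1.trans (map_zero _).symm))
      exact ⟨k, hdd.inj hx⟩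

lemma exists_cosyzygy [IsNoetherianRing R] (h : TotRefl R H) :
    ∃ (n : ℕ) (H₁ : ModuleCat.{u} R) (f : H →ₗ[R] (Fin n → R)) (g : (Fin n → R) →ₗ[R] H₁),
      SES f g ∧ TotRefl R H₁ := by
  have := h.dual.finite
  obtain ⟨n, p, hp⟩ := Module.Finite.exists_fin' R (H →ₗ[R] R)
  have hs := SES.ker_subtype hp
  have hK := h.dual.syzygy hs
  have hd := hs.lcomp (X := R) (hs.exists_extend (h.dual.ext 1 one_pos))
  exact ⟨n, ModuleCat.of R _, _, _,
    hd.congr h.equiv (LinearEquiv.piRing R R (Fin n) R) (LinearEquiv.refl R _), hK.dual⟩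

end TotRefl

end Reflexive

section Canonical

variable {R : Type u} [CommRing R] {ω : Type u} [AddCommGroup ω] [Module R ω]

lemma IsSemidualizing.annihilator_eq_bot (h : IsSemidualizing R ω) :
    Module.annihilator R ω = ⊥ := by
  refine (Submodule.eq_bot_iff _).mpr fun r hr => h.2.1.1 ?_
  rw [map_zero]
  ext w
  exact Module.mem_annihilator.mp hr w

lemma IsSemidualizing.extVan (h : IsSemidualizing R ω) {i : ℕ} (hi : 0 < i) : ExtVan R ω ω i :=
  subsingleton_extGrp_iff.mp (h.2.2 i hi)

lemma HasFiniteInjDim.exists_extVan (h : HasFiniteInjDim R ω) :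
    ∃ N, ∀ (M : Type u) [AddCommGroup M] [Module R M] (i : ℕ), N < i → ExtVan R M ω i := by
  obtain ⟨N, hN⟩ := h
  exact ⟨N, fun M _ _ i hi => subsingleton_extGrp_iff.mp (hN (ModuleCat.of R M) i hi)⟩

/-- Maps `ω → Hom(K, ω)` extend along `f : K → F` when linear forms do. -/
lemma exists_lift_hom_of_extend (hω : Function.Bijective (LinearMap.lsmul R ω)) {K F : Type u}
    [AddCommGroup K] [Module R K] [AddCommGroup F] [Module R F] {f : K →ₗ[R] F}
    (hf : ∀ φ : K →ₗ[R] R, ∃ ψ : F →ₗ[R] R, ψ ∘ₗ f = φ) (φ : ω →ₗ[R] (K →ₗ[R] ω)) :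
    ∃ ψ : ω →ₗ[R] (F →ₗ[R] ω), f.lcomp R ω ∘ₗ ψ = φ := by
  obtain ⟨r, rfl⟩ := (homSemiEquiv hω K).surjective φ
  obtain ⟨s, rfl⟩ := hf r
  exact ⟨homSemiEquiv hω F s, rfl⟩

variable [IsNoetherianRing R]

lemma TotRefl.extVan_of_finiteInjDim (hω : HasFiniteInjDim R ω) {i : ℕ} (hi : 0 < i)
    {H : Type u} [AddCommGroup H] [Module R H] (h : TotRefl R H) : ExtVan R H ω i := by
  obtain ⟨N, hN⟩ := hω.exists_extVan
  have key : ∀ (k i : ℕ) (_ : N < i + k) (_ : 0 < i) (H : Type u) [AddCommGroup H] [Module R H],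
      TotRefl R H → ExtVan R H ω i := by
    intro k
    induction k with
    | zero => exact fun i hi _ H _ _ _ => hN H i hi
    | succ k ih =>
      intro i hi h0 H _ _ h
      obtain ⟨n, H₁, f, g, hs, h₁⟩ := h.exists_cosyzygy
      exact hs.van_first_left (ExtVan.of_proj h0) (ih (i + 1) (by omega) (by omega) H₁ h₁)
  exact key (N + 1) i (by omega) hi H h

lemma IsCanonicalModule.extVan_hom (hω : IsCanonicalModule R ω) (i : ℕ) :
    ∀ (H : Type u) [AddCommGroup H] [Module R H] (_ : TotRefl R H),
      ExtVan R ω (H →ₗ[R] ω) (i + 1) := by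
  have hfree (n i : ℕ) : ExtVan R ω ((Fin n → R) →ₗ[R] ω) (i + 1) :=
    (hω.1.extVan i.succ_pos).pi_right.congr_right (LinearEquiv.piRing R ω (Fin n) R).symm
  induction i with
  | zero =>
    intro H _ _ h
    have := h.finite
    obtain ⟨n, p, hp⟩ := Module.Finite.exists_fin' R H
    have hs := SES.ker_subtype hp
    exact (hs.lcomp (hs.exists_extend (h.extVan_of_finiteInjDim hω.2 one_pos))).van_one_of_lift
      (hfree n 0) (exists_lift_hom_of_extend hω.1.2.1 (hs.exists_extend (h.ext 1 one_pos)))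
  | succ i ih =>
    intro H _ _ h
    have := h.finite
    obtain ⟨n, p, hp⟩ := Module.Finite.exists_fin' R H
    have hs := SES.ker_subtype hp
    exact (hs.lcomp (hs.exists_extend (h.extVan_of_finiteInjDim hω.2 one_pos))).van_first_right
      (ih _ (h.syzygy hs)) (hfree n _)

lemma IsCanonicalModule.evalMap_hom_surjective (hω : IsCanonicalModule R ω)
    {H : Type u} [AddCommGroup H] [Module R H] (h : TotRefl R H) :
    Function.Surjective (evalMap R ω (H →ₗ[R] ω)) := by
  obtain ⟨n, H₁, f, g, hs, h₁⟩ := h.exists_cosyzygy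
  exact evalMap_surjective_of_ses
    (hs.lcomp (hs.exists_extend (h₁.extVan_of_finiteInjDim hω.2 one_pos)))
    (evalMap_hom_bijective hω.1.2.1 _).2

lemma IsCanonicalModule.evalMap_hom_bijective (hω : IsCanonicalModule R ω)
    {H : Type u} [AddCommGroup H] [Module R H] (h : TotRefl R H) :
    Function.Bijective (evalMap R ω (H →ₗ[R] ω)) := by
  refine ⟨?_, hω.evalMap_hom_surjective h⟩
  obtain ⟨n, H₁, f, g, hs, h₁⟩ := h.exists_cosyzygy
  exact evalMap_injective_of_ses
    (hs.lcomp (hs.exists_extend (h₁.extVan_of_finiteInjDim hω.2 one_pos)))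
    (exists_lift_hom_of_extend hω.1.2.1 (hs.exists_extend (h₁.ext 1 one_pos)))
    (Paper.evalMap_hom_bijective hω.1.2.1 _).1 (hω.evalMap_hom_surjective h₁)

lemma IsCanonicalModule.bassLike_hom_injective (hω : IsCanonicalModule R ω)
    {G : Type u} [AddCommGroup G] [Module R G] (h : TotRefl R G)
    (J : Type u) [AddCommGroup J] [Module R J] [Module.Injective R J] :
    BassLike R ω (G →ₗ[R] J) := by
  have := hω.1.1
  have h1 := BassLike.hom_injective (J := J) (hω.evalMap_hom_bijective h.dual) fun i hi => by
    obtain ⟨i, rfl⟩ := Nat.exists_eq_succ_of_ne_zero hi.ne'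
    exact hω.extVan_hom i _ h.dual
  exact h1.congr (LinearEquiv.congrLeft J R
    (h.equiv.trans (homSemiEquiv hω.1.2.1 _))).symm

lemma IsCanonicalModule.bassLike_hom_of_gdim (hω : IsCanonicalModule R ω)
    {T : Type u} [AddCommGroup T] [Module R T] (h : GCdimFinite R R T)
    (J : Type u) [AddCommGroup J] [Module R J] [Module.Injective R J] :
    BassLike R ω (T →ₗ[R] J) := by
  have := hω.1.1
  obtain ⟨n, G, d, ε, hε, h0, hd, hG, hn⟩ := h
  have step {A B C : Type u} [AddCommGroup A] [Module R A] [AddCommGroup B] [Module R B]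
      [AddCommGroup C] [Module R C] {f : A →ₗ[R] B} {g : B →ₗ[R] C} (hs : SES f g)
      (hB : BassLike R ω (B →ₗ[R] J)) (hA : BassLike R ω (A →ₗ[R] J)) :
      BassLike R ω (C →ₗ[R] J) :=
    BassLike.of_ses hω.1.annihilator_eq_bot
      (hs.lcomp (X := J) (exists_extend_of_injective hs.inj)) hB hA
  have hGi (i : ℕ) : BassLike R ω (G i →ₗ[R] J) := hω.bassLike_hom_injective (hG i).totRefl J
  have key : ∀ k i : ℕ, n < i + k → BassLike R ω (LinearMap.range (d i) →ₗ[R] J) := by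
    intro k
    induction k with
    | zero =>
      intro i hi
      have := hn i hi
      exact BassLike.of_subsingleton
    | succ k ih =>
      intro i hi
      have hker : LinearMap.range (d (i + 1)) = LinearMap.ker (d i).rangeRestrict := by
        rw [LinearMap.ker_rangeRestrict, hd]
      have h1 := ih (i + 1) (by omega)
      rw [hker] at h1
      exact step (SES.ker_subtype (d i).surjective_rangeRestrict) (hGi _) h1
  have h1 := key (n + 1) 0 (by omega)
  rw [h0] at h1
  exact step (SES.ker_subtype hε) (hGi _) h1

end Canonical

section InjDim

lemma exists_injective_embedding (R : Type u) [CommRing R] (X : Type u) [AddCommGroup X]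
    [Module R X] : ∃ (J : ModuleCat.{u} R) (j : X →ₗ[R] J), Module.Injective R J ∧
      Function.Injective j := by
  let j := Injective.ι (ModuleCat.of R X)
  refine ⟨Injective.under (ModuleCat.of R X), j.hom, ?_, (ModuleCat.mono_iff_injective j).mp
    inferInstance⟩
  exact @Module.injective_module_of_injective_object R _ _ _ _
    (inferInstanceAs (Injective (Injective.under (ModuleCat.of R X))))

lemma SES.restrictScalars {R A : Type u} [CommRing R] [CommRing A] [Algebra R A] {X Y Z : Type u}
    [AddCommGroup X] [Module R X] [Module A X] [IsScalarTower R A X]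
    [AddCommGroup Y] [Module R Y] [Module A Y] [IsScalarTower R A Y]
    [AddCommGroup Z] [Module R Z] [Module A Z] [IsScalarTower R A Z]
    {f : X →ₗ[A] Y} {g : Y →ₗ[A] Z} (h : SES f g) :
    SES (f.restrictScalars R) (g.restrictScalars R) :=
  ⟨h.inj, h.surj, h.exact⟩

variable {R : Type u} [CommRing R] {ω : Type u} [AddCommGroup ω] [Module R ω] {a : Ideal R}

/-- Additive maps between modules over a quotient ring that are linear over the base ring are
linear over the quotient. -/
def extendQuotient {X Y : Type u} [AddCommGroup X] [Module R X] [Module (R ⧸ a) X]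
    [IsScalarTower R (R ⧸ a) X] [AddCommGroup Y] [Module R Y] [Module (R ⧸ a) Y]
    [IsScalarTower R (R ⧸ a) Y] (f : X →ₗ[R] Y) : X →ₗ[R ⧸ a] Y where
  toFun := f
  map_add' := f.map_add
  map_smul' := fun c x => by
    obtain ⟨r, rfl⟩ := Ideal.Quotient.mk_surjective c
    exact (congrArg f (algebraMap_smul (R ⧸ a) r x)).trans
      ((f.map_smul r x).trans (algebraMap_smul (R ⧸ a) r (f x)).symm)

lemma IsCanonicalModule.bassLike_of_injective [IsNoetherianRing R] (hω : IsCanonicalModule R ω)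
    (ha : GCdimFinite R R (R ⧸ a)) (X : Type u) [AddCommGroup X] [Module R X] [Module (R ⧸ a) X]
    [IsScalarTower R (R ⧸ a) X] [Module.Injective (R ⧸ a) X] : BassLike R ω X := by
  obtain ⟨J, j, hJ, hj⟩ := exists_injective_embedding R X
  have htor : Module.IsTorsionBySet R (R ⧸ a →ₗ[R] J) a := by
    rintro φ ⟨r, hr⟩
    ext
    change r • φ 1 = 0
    rw [← map_smul, Algebra.smul_def, mul_one, Ideal.Quotient.algebraMap_eq,
      Ideal.Quotient.eq_zero_iff_mem.mpr hr, map_zero]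
  let _ : Module (R ⧸ a) (R ⧸ a →ₗ[R] J) := htor.module
  have : IsScalarTower R (R ⧸ a) (R ⧸ a →ₗ[R] J) := htor.isScalarTower
  let s : X →ₗ[R] (R ⧸ a →ₗ[R] J) := LinearMap.mk₂ R (fun x c => j (c • x))
    (by simp) (by intros; rw [smul_comm]; simp) (by simp [add_smul]) (by simp)
  have hs : Function.Injective (extendQuotient (a := a) s) := fun x y h => hj (by
    have h1 : j ((1 : R ⧸ a) • x) = j ((1 : R ⧸ a) • y) := LinearMap.congr_fun h 1
    rwa [one_smul, one_smul] at h1)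
  obtain ⟨r, hr⟩ := exists_extend_of_injective hs (LinearMap.id : X →ₗ[R ⧸ a] X)
  exact (hω.bassLike_hom_of_gdim ha J).of_retract s (r.restrictScalars R)
    (LinearMap.ext fun x => LinearMap.congr_fun hr x)

lemma IsCanonicalModule.bassLike_of_extVan [IsNoetherianRing R] (hω : IsCanonicalModule R ω)
    (ha : GCdimFinite R R (R ⧸ a)) (n : ℕ) :
    ∀ (X : Type u) [AddCommGroup X] [Module R X] [Module (R ⧸ a) X] [IsScalarTower R (R ⧸ a) X]
      (_ : ∀ (M : Type u) [AddCommGroup M] [Module (R ⧸ a) M] (i : ℕ), n < i →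
        ExtVan (R ⧸ a) M X i), BassLike R ω X := by
  have := hω.1.1
  induction n with
  | zero =>
    intro X _ _ _ _ h
    have : Module.Injective (R ⧸ a) X := ⟨fun M N _ _ _ _ f hf φ => by
      have hs : SES f (LinearMap.range f).mkQ :=
        ⟨hf, Submodule.mkQ_surjective _, LinearMap.exact_map_mkQ_range f⟩
      obtain ⟨ψ, hψ⟩ := hs.exists_extend (h _ 1 one_pos) φ
      exact ⟨ψ, LinearMap.congr_fun hψ⟩⟩
    exact hω.bassLike_of_injective ha X
  | succ n ih =>
    intro X _ _ _ _ h
    obtain ⟨I, f, hI, hf⟩ := exists_injective_embedding (R ⧸ a) X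
    let _ : Module R I := Module.compHom I (algebraMap R (R ⧸ a))
    have : IsScalarTower R (R ⧸ a) I := IsScalarTower.of_algebraMap_smul fun _ _ => rfl
    have hs : SES f (LinearMap.range f).mkQ :=
      ⟨hf, Submodule.mkQ_surjective _, LinearMap.exact_map_mkQ_range f⟩
    refine BassLike.of_ses hω.1.annihilator_eq_bot hs.restrictScalars
      (hω.bassLike_of_injective ha I) (ih _ fun M _ _ i hi => ?_)
    exact hs.van_third_right (ExtVan.of_inj (by omega)) (h M _ (by omega))

lemma IsCanonicalModule.bassLike_canonical [IsNoetherianRing R] (hω : IsCanonicalModule R ω)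
    (ha : GCdimFinite R R (R ⧸ a)) {X : Type u} [AddCommGroup X] [Module R X] [Module (R ⧸ a) X]
    [IsScalarTower R (R ⧸ a) X] (hX : HasFiniteInjDim (R ⧸ a) X) : BassLike R ω X := by
  obtain ⟨N, hN⟩ := hX.exists_extVan
  exact hω.bassLike_of_extVan ha N X hN

end InjDim

section RegularElement

variable {R : Type u} [CommRing R] {M M' Y Z : Type u} [AddCommGroup M] [Module R M]
  [AddCommGroup M'] [Module R M'] [AddCommGroup Y] [Module R Y] [AddCommGroup Z] [Module R Z]
  {x : R} {g : Y →ₗ[R] Z}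

lemma smul_ext_eq_zero (hM : ∀ m : M, x • m = 0) {i : ℕ}
    (z : Abelian.Ext (ModuleCat.of R M) (ModuleCat.of R Y) i) : x • z = 0 := by
  have h : x • 𝟙 (ModuleCat.of R M) = 0 := by
    ext m
    exact hM m
  have h1 := Abelian.Ext.mk₀_id_comp z
  rw [← h1, ← Abelian.Ext.smul_comp, ← Abelian.Ext.mk₀_smul, h, Abelian.Ext.mk₀_zero,
    Abelian.Ext.zero_comp]

lemma comp_smul_eq_zero (hM : ∀ m : M, x • m = 0) {i : ℕ}
    (z : Abelian.Ext (ModuleCat.of R M) (ModuleCat.of R Y) i) :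
    z.comp (Abelian.Ext.mk₀ (ModuleCat.ofHom (LinearMap.lsmul R Y x))) (add_zero i) = 0 := by
  have h : ModuleCat.ofHom (LinearMap.lsmul R Y x) = x • 𝟙 (ModuleCat.of R Y) := rfl
  rw [h, ← Abelian.Ext.smul_eq_comp_mk₀, smul_ext_eq_zero hM]

variable (h : SES (LinearMap.lsmul R Y x) g)
include h

lemma extVan_of_lt_succ (hM : ∀ m : M, x • m = 0) {l : ℕ}
    (hZ : ∀ i < l, ExtVan R M Z i) : ∀ i < l + 1, ExtVan R M Y i := by
  rintro (_ | i) hi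
  · refine extVan_zero_iff.mpr fun f => LinearMap.ext fun m => h.inj ?_
    simp [← map_smul, hM]
  · refine extVan_iff.mpr fun z => ?_
    obtain ⟨y, rfl⟩ := Abelian.Ext.covariant_sequence_exact₁ _ h.shortExact z
      (comp_smul_eq_zero hM z) rfl
    rw [extVan_iff.mp (hZ i (by lia)) y, Abelian.Ext.zero_comp]

lemma connecting_bijective (hM : ∀ m : M, x • m = 0) {l : ℕ} (hY : ExtVan R M Y l) :
    Function.Bijective (fun y : Abelian.Ext (ModuleCat.of R M) (ModuleCat.of R Z) l =>
      y.comp h.shortExact.extClass (rfl : l + 1 = l + 1)) := by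
  constructor
  · intro y y' hyy
    rw [← sub_eq_zero]
    obtain ⟨t, ht⟩ := Abelian.Ext.covariant_sequence_exact₃ _ h.shortExact (y - y') rfl (by
      rw [sub_eq_add_neg, Abelian.Ext.add_comp, Abelian.Ext.neg_comp, ← sub_eq_add_neg]
      exact sub_eq_zero.mpr hyy)
    rw [← ht, extVan_iff.mp hY t, Abelian.Ext.zero_comp]
  · intro z
    exact Abelian.Ext.covariant_sequence_exact₁ _ h.shortExact z (comp_smul_eq_zero hM z) rfl

lemma nonempty_ext_equiv_ext_succ (hM : ∀ m : M, x • m = 0) {l : ℕ} (hY : ExtVan R M Y l) :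
    Nonempty (Abelian.Ext (ModuleCat.of R M) (ModuleCat.of R Z) l ≃ₗ[R]
      Abelian.Ext (ModuleCat.of R M) (ModuleCat.of R Y) (l + 1)) :=
  ⟨LinearEquiv.ofBijective
    (h.shortExact.extClass.postcompOfLinear R (ModuleCat.of R M) (rfl : l + 1 = l + 1))
    (connecting_bijective h hM hY)⟩

lemma ext_comp_surjective (hM : ∀ m : M, x • m = 0) (hM' : ∀ m : M', x • m = 0) {l : ℕ}
    (hY : ExtVan R M' Y l) (f : M' →ₗ[R] M)
    (hs : Function.Surjective fun z : Abelian.Ext (ModuleCat.of R M) (ModuleCat.of R Y) (l + 1) =>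
      (Abelian.Ext.mk₀ (ModuleCat.ofHom f)).comp z (zero_add (l + 1))) :
    Function.Surjective fun z : Abelian.Ext (ModuleCat.of R M) (ModuleCat.of R Z) l =>
      (Abelian.Ext.mk₀ (ModuleCat.ofHom f)).comp z (zero_add l) := by
  intro y
  obtain ⟨z, hz⟩ := hs (y.comp h.shortExact.extClass rfl)
  obtain ⟨w, rfl⟩ := Abelian.Ext.covariant_sequence_exact₁ _ h.shortExact z
    (comp_smul_eq_zero hM z) rfl
  refine ⟨w, (connecting_bijective h hM' hY).1 ?_⟩
  dsimp only at hz ⊢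
  rw [← hz, Abelian.Ext.comp_assoc _ _ _ (zero_add l) rfl (by lia)]

end RegularElement

section Reduction

variable {R : Type u} [CommRing R]

/-- The passage from `W` to `W' = W / (xs) W` for a sequence `xs` of length `n`, as seen by
`Ext` from modules killed by `xs`. -/
structure Reduction (ω W W' : Type u) [AddCommGroup ω] [Module R ω] [AddCommGroup W] [Module R W]
    [AddCommGroup W'] [Module R W'] (xs : List R) : Prop where
  van : ∀ (M : Type u) [AddCommGroup M] [Module R M], (∀ x ∈ xs, ∀ m : M, x • m = 0) →
    ∀ i < xs.length, ExtVan R M W i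
  van_hom : ∀ (M : Type u) [AddCommGroup M] [Module R M], (∀ x ∈ xs, ∀ m : M, x • m = 0) →
    ∀ i < xs.length, ExtVan R M (ω →ₗ[R] W) i
  equiv : ∀ (M : Type u) [AddCommGroup M] [Module R M], (∀ x ∈ xs, ∀ m : M, x • m = 0) →
    Nonempty (Abelian.Ext (ModuleCat.of R M) (ModuleCat.of R (ω →ₗ[R] W)) xs.length ≃ₗ[R]
      (M →ₗ[R] (ω →ₗ[R] W')))
  extend : ∀ (M M' : Type u) [AddCommGroup M] [Module R M] [AddCommGroup M'] [Module R M'],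
    (∀ x ∈ xs, ∀ m : M, x • m = 0) → (∀ x ∈ xs, ∀ m : M', x • m = 0) → ∀ f : M' →ₗ[R] M,
    (Function.Surjective fun z : Abelian.Ext (ModuleCat.of R M) (ModuleCat.of R W) xs.length =>
      (Abelian.Ext.mk₀ (ModuleCat.ofHom f)).comp z (zero_add xs.length)) →
    ∀ φ : M' →ₗ[R] W', ∃ ψ : M →ₗ[R] W', ψ ∘ₗ f = φ
  bound : ∀ (Y : Type u) [AddCommGroup Y] [Module R Y] (n : ℕ),
    (∀ i, n < i → ExtVan R (ω →ₗ[R] W) Y i) →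
    ∀ i, n + xs.length < i → ExtVan R (ω →ₗ[R] W') Y i
  smul_eq_zero : ∀ x ∈ xs, ∀ w : W', x • w = 0

variable {ω W V W' : Type u} [AddCommGroup ω] [Module R ω] [AddCommGroup W] [Module R W]
  [AddCommGroup V] [Module R V] [AddCommGroup W'] [Module R W']

lemma Reduction.nil : Reduction (R := R) ω W W [] where
  van := by simp
  van_hom := by simp
  equiv M _ _ _ := ⟨Abelian.Ext.linearEquiv₀.trans ModuleCat.homLinearEquiv⟩
  extend M M' _ _ _ _ _ _ f hs φ := by
    obtain ⟨y, hy⟩ := hs (Abelian.Ext.mk₀ (ModuleCat.ofHom φ))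
    obtain ⟨y, rfl⟩ := Abelian.Ext.mk₀_bijective _ _ |>.2 y
    dsimp only at hy
    rw [Abelian.Ext.mk₀_comp_mk₀] at hy
    exact ⟨y.hom, congrArg ModuleCat.Hom.hom ((Abelian.Ext.mk₀_bijective _ _).1 hy)⟩
  bound Y _ _ n h := h
  smul_eq_zero := by simp

lemma Reduction.cons {x : R} {xs : List R} {g : W →ₗ[R] V}
    (h : SES (LinearMap.lsmul R W x) g)
    (hl : ∀ φ : ω →ₗ[R] V, ∃ ψ : ω →ₗ[R] W, g ∘ₗ ψ = φ) (hV : ∀ w : W', x • w = 0)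
    (H : Reduction (R := R) ω V W' xs) : Reduction (R := R) ω W W' (x :: xs) := by
  have hh : SES (LinearMap.lsmul R (ω →ₗ[R] W) x) (g.compRight R (M := ω)) := h.compRight hl
  have van (M : Type u) [AddCommGroup M] [Module R M] (hM : ∀ y ∈ x :: xs, ∀ m : M, y • m = 0) :=
    extVan_of_lt_succ h (hM x (by simp)) (H.van M fun y hy => hM y (by simp [hy]))
  have van_hom (M : Type u) [AddCommGroup M] [Module R M]
      (hM : ∀ y ∈ x :: xs, ∀ m : M, y • m = 0) :=
    extVan_of_lt_succ hh (hM x (by simp)) (H.van_hom M fun y hy => hM y (by simp [hy]))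
  refine ⟨van, van_hom, ?_, ?_, ?_, ?_⟩
  · intro M _ _ hM
    obtain ⟨e⟩ := H.equiv M fun y hy => hM y (by simp [hy])
    obtain ⟨e'⟩ := nonempty_ext_equiv_ext_succ hh (hM x (by simp))
      (van_hom M hM xs.length (by simp))
    exact ⟨e'.symm.trans e⟩
  · intro M M' _ _ _ _ hM hM' f hs
    exact H.extend M M' (fun y hy => hM y (by simp [hy])) (fun y hy => hM' y (by simp [hy])) f
      (ext_comp_surjective h (hM x (by simp)) (hM' x (by simp))
        (van M' hM' xs.length (by simp)) f hs)
  · intro Y _ _ n hn i hi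
    refine H.bound Y (n + 1) (fun i hi => ?_) i (by simp at hi; lia)
    obtain ⟨j, rfl⟩ := Nat.exists_eq_add_of_le' (by lia : 1 ≤ i)
    exact hh.van_third_left (hn _ (by lia)) (hn _ (by lia))
  · simpa using ⟨hV, H.smul_eq_zero⟩

end Reduction

section Reduction

variable {R : Type u} [CommRing R] [IsNoetherianRing R] [IsLocalRing R]

open scoped Pointwise in
theorem exists_reduction {ω : Type u} [AddCommGroup ω] [Module R ω] [Module.Finite R ω]
    (hω : Module.annihilator R ω = ⊥) (xs : List R) (hxs : ∀ x ∈ xs, x ∈ IsLocalRing.maximalIdeal R)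
    (W : Type u) [AddCommGroup W] [Module R W] [Module.Finite R W] [Nontrivial W]
    (hW : ∃ π : ω →ₗ[R] W, Function.Surjective π ∧ ∀ ψ : ω →ₗ[R] W, ∃ r : R, ψ = r • π)
    (hext : ∀ i, 0 < i → ExtVan R ω W i)
    (hreg : RingTheory.Sequence.IsWeaklyRegular (ω →ₗ[R] W) xs) :
    ∃ (W' : Type u) (_ : AddCommGroup W') (_ : Module R W') (_ : Module.Finite R W')
      (_ : Nontrivial W') (π : ω →ₗ[R] W') (q : W →ₗ[R] W'), Function.Surjective π ∧
      (∀ ψ : ω →ₗ[R] W', ∃ r : R, ψ = r • π) ∧ Function.Surjective q ∧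
      Reduction (R := R) ω W W' xs := by
  induction xs generalizing W with
  | nil =>
    obtain ⟨π, hπ, hψ⟩ := hW
    exact ⟨W, _, _, inferInstance, inferInstance, π, LinearMap.id, hπ, hψ,
      Function.surjective_id, .nil⟩
  | cons x xs ih =>
    obtain ⟨hx, hr⟩ := (RingTheory.Sequence.isWeaklyRegular_cons_iff _ _ _).mp hreg
    have hinj : Function.Injective (LinearMap.lsmul R W x) := by
      rw [← LinearMap.ker_eq_bot, ← Submodule.subsingleton_iff_eq_bot]
      refine subsingleton_of_hom_eq_zero hω fun f => ?_
      have h0 : (LinearMap.ker (LinearMap.lsmul R W x)).subtype ∘ₗ f = 0 := by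
        refine hx ?_
        ext w
        exact (LinearMap.mem_ker.mp (f w).2).trans (smul_zero x).symm
      ext w
      exact LinearMap.congr_fun h0 w
    have h : SES (LinearMap.lsmul R W x) (LinearMap.range (LinearMap.lsmul R W x)).mkQ :=
      ⟨hinj, Submodule.mkQ_surjective _, LinearMap.exact_map_mkQ_range _⟩
    have hl : ∀ φ : ω →ₗ[R] W ⧸ LinearMap.range (LinearMap.lsmul R W x), ∃ ψ : ω →ₗ[R] W,
        (LinearMap.range (LinearMap.lsmul R W x)).mkQ ∘ₗ ψ = φ :=
      fun φ => h.exists_lift (hext 1 one_pos) φ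
    have hh := h.compRight hl
    have hrange : LinearMap.range (LinearMap.lsmul R W x) = x • (⊤ : Submodule R W) := by
      ext w; simp [Submodule.mem_smul_pointwise_iff_exists]
    have hmem := hxs x (by simp)
    have : Nontrivial (W ⧸ LinearMap.range (LinearMap.lsmul R W x)) := by
      rw [Submodule.Quotient.nontrivial_iff, hrange]
      refine (Submodule.top_ne_pointwise_smul_of_mem_jacobson_annihilator ?_).symm
      exact IsLocalRing.maximalIdeal_le_jacobson _ hmem
    have hrange' : x • (⊤ : Submodule R (ω →ₗ[R] W)) = LinearMap.ker
        ((LinearMap.range (LinearMap.lsmul R W x)).mkQ.compRight R (M := ω)) := by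
      rw [hh.exact.linearMap_ker_eq]
      ext w; simp [Submodule.mem_smul_pointwise_iff_exists, LinearMap.ext_iff]
    obtain ⟨π, hπ, hψ⟩ := hW
    obtain ⟨W', i1, i2, i3, i4, π', q, hπ', hψ', hq, H⟩ :=
      ih (fun y hy => hxs y (by simp [hy])) (W ⧸ LinearMap.range (LinearMap.lsmul R W x))
        ⟨(LinearMap.range (LinearMap.lsmul R W x)).mkQ ∘ₗ π, h.surj.comp hπ, fun φ => by
          obtain ⟨ψ, rfl⟩ := hl φ
          obtain ⟨r, rfl⟩ := hψ ψ
          exact ⟨r, by ext; simp⟩⟩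
        (fun i hi => h.van_third_right (hext i hi) (hext _ (by lia)))
        (((Submodule.quotEquivOfEq _ _ hrange').trans
          (LinearMap.quotKerEquivOfSurjective _ hh.surj)).isWeaklyRegular_congr xs |>.mp hr)
    refine ⟨W', i1, i2, i3, i4, π', q ∘ₗ Submodule.mkQ _, hπ', hψ', hq.comp h.surj,
      .cons h hl (fun w => ?_) H⟩
    obtain ⟨v, rfl⟩ := hq w
    obtain ⟨w, rfl⟩ := h.surj v
    rw [← map_smul, ← map_smul]
    have : (LinearMap.range (LinearMap.lsmul R W x)).mkQ (x • w) = 0 := by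
      simp only [Submodule.mkQ_apply, Submodule.Quotient.mk_eq_zero]
      exact ⟨w, rfl⟩
    rw [this, map_zero]

end Reduction

section TypeLemma

open IsLocalRing

variable {R : Type u} [CommRing R] [IsNoetherianRing R] [IsLocalRing R]

lemma exists_injective_residue {M : Type u} [AddCommGroup M] [Module R M] [Nontrivial M] {n : ℕ}
    (hM : maximalIdeal R ^ n ≤ Module.annihilator R M) :
    ∃ f : (R ⧸ maximalIdeal R) →ₗ[R] M, Function.Injective f := by
  obtain ⟨p, hp⟩ := associatedPrimes.nonempty R M
  obtain ⟨h1, h2⟩ := (isAssociatedPrime_iff_exists_injective_linearMap p M).mp hp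
  have h3 : maximalIdeal R ^ n ≤ p :=
    (hM.trans Submodule.annihilator_top.ge).trans (IsAssociatedPrime.annihilator_le hp)
  have h4 : p = maximalIdeal R := (le_maximalIdeal h1.ne_top).antisymm (h1.le_of_pow_le h3)
  exact h4 ▸ h2

lemma ExtVan.of_residue {Y : Type u} [AddCommGroup Y] [Module R Y] {i : ℕ}
    (h : ExtVan R (R ⧸ maximalIdeal R) Y i) (M : Type u) [AddCommGroup M] [Module R M]
    [Module.Finite R M] {n : ℕ} (hM : maximalIdeal R ^ n ≤ Module.annihilator R M) :
    ExtVan R M Y i := by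
  revert hM
  refine IsNoetherianRing.induction_on_isQuotientEquivQuotientPrime (A := R) (M := M) inferInstance
    (motive := fun M _ _ _ => maximalIdeal R ^ n ≤ Module.annihilator R M → ExtVan R M Y i)
    ?_ ?_ ?_
  · intro N _ _ _ _ _
    exact h.of_retract_left 0 0 (LinearMap.ext fun x => Subsingleton.elim _ _)
  · intro N _ _ _ p e hN
    rw [e.annihilator_eq, Ideal.annihilator_quotient] at hN
    have : p.1 = maximalIdeal R :=
      (le_maximalIdeal p.2.ne_top).antisymm (p.2.le_of_pow_le hN)
    exact h.congr_left (e.trans (Submodule.quotEquivOfEq _ _ this)).symm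
  · intro A _ _ _ B _ _ _ C _ _ _ f g hf hg hfg hA hC hB
    exact SES.van_mid_left ⟨hf, hg, hfg⟩ (hC (hB.trans (LinearMap.annihilator_le_of_surjective g hg)))
      (hA (hB.trans (LinearMap.annihilator_le_of_injective f hf)))

omit [IsNoetherianRing R] in
lemma le_radical_of_ringKrullDim_quotient_eq_zero {I : Ideal R} (h : ringKrullDim (R ⧸ I) = 0) :
    maximalIdeal R ≤ I.radical := by
  have : Ring.KrullDimLE 0 (R ⧸ I) := Ring.krullDimLE_iff.mpr (by simp [h])
  rw [Ideal.radical_eq_sInf]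
  refine le_sInf fun p ⟨hIp, hp⟩ => ?_
  have h1 : (p.map (Ideal.Quotient.mk I)).IsPrime :=
    Ideal.map_isPrime_of_surjective Ideal.Quotient.mk_surjective (by simpa using hIp)
  have h2 := (Ideal.isMaximal_of_isPrime (p.map (Ideal.Quotient.mk I)))
  have h3 := Ideal.comap_isMaximal_of_surjective (Ideal.Quotient.mk I)
    Ideal.Quotient.mk_surjective (K := p.map (Ideal.Quotient.mk I))
  rw [Ideal.comap_map_of_surjective _ Ideal.Quotient.mk_surjective, ← RingHom.ker_eq_comap_bot,
    Ideal.mk_ker, sup_eq_left.mpr hIp] at h3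
  exact (eq_maximalIdeal h3).ge

lemma exists_isRegular_of_ldepth_eq (hCM : (ldepth R R : WithBot ℕ∞) = ringKrullDim R) :
    ∃ xs : List R, xs.length = (ldepth R R).toNat ∧ (∀ x ∈ xs, x ∈ maximalIdeal R) ∧
      RingTheory.Sequence.IsRegular R xs ∧ ∃ n, maximalIdeal R ^ n ≤ Ideal.ofList xs := by
  have htop : ldepth R R ≠ ⊤ := by
    intro h
    have := ringKrullDim_ne_top (R := R)
    rw [← hCM, h] at this
    exact this rfl
  have hlt : maximalIdeal R • (⊤ : Submodule R (ModuleCat.of R R)) < ⊤ := by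
    refine lt_of_le_of_ne le_top fun h => (maximalIdeal.isMaximal R).ne_top ?_
    simpa using h
  have hext : ∀ i < (ldepth R R).toNat, ExtVan R (R ⧸ maximalIdeal R) R i := by
    intro i hi
    by_contra hc
    have h1 : Nontrivial (ExtGrp R (R ⧸ maximalIdeal R) R i) := by
      rwa [← not_subsingleton_iff_nontrivial, subsingleton_extGrp_iff]
    have h2 : ldepth R R ≤ i := sInf_le ⟨i, rfl, h1⟩
    rw [← ENat.natCast_toNat htop, Nat.cast_le] at h2
    lia
  have : Module.Finite R (ModuleCat.of R (R ⧸ maximalIdeal R)) :=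
    inferInstanceAs (Module.Finite R (R ⧸ maximalIdeal R))
  have : Module.Finite R (ModuleCat.of R R) := inferInstanceAs (Module.Finite R R)
  obtain ⟨xs, hlen, hmem, hreg⟩ := ModuleCat.exists_isRegular_of_exists_subsingleton_ext
    (maximalIdeal R) (ldepth R R).toNat (ModuleCat.of R R) hlt
    (ModuleCat.of R (R ⧸ maximalIdeal R)) (by
      change Module.support R (R ⧸ maximalIdeal R) = _
      rw [Module.support_eq_zeroLocus, Ideal.annihilator_quotient]) hext
  refine ⟨xs, hlen, hmem, hreg, ?_⟩
  have h1 := ringKrullDim_add_length_eq_ringKrullDim_of_isRegular xs hreg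
  rw [hlen, ← hCM, ← ENat.natCast_toNat htop] at h1
  refine Ideal.exists_pow_le_of_le_radical_of_fg (le_radical_of_ringKrullDim_quotient_eq_zero ?_)
    (IsNoetherian.noetherian _)
  exact ENat.WithBot.add_natCast_cancel.mp (h1.trans (zero_add _).symm)

theorem IsCanonicalModule.nonempty_ext_equiv {ω : Type u} [AddCommGroup ω] [Module R ω]
    (hω : IsCanonicalModule R ω) (hCM : (ldepth R R : WithBot ℕ∞) = ringKrullDim R) :
    Nonempty (ExtGrp R (R ⧸ maximalIdeal R) R (ldepth R R).toNat ≃ₗ[R]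
      (ω →ₗ[R] R ⧸ maximalIdeal R)) := by
  obtain ⟨xs, hlen, hmem, hreg, n, hn⟩ := exists_isRegular_of_ldepth_eq hCM
  rw [← hlen]
  have := hω.1.1
  have hann := hω.1.annihilator_eq_bot
  have e₀ : R ≃ₗ[R] (ω →ₗ[R] ω) := LinearEquiv.ofBijective _ hω.1.2.1
  have : Nontrivial ω := by
    by_contra h
    rw [not_nontrivial_iff_subsingleton] at h
    exact one_ne_zero (e₀.injective (LinearMap.ext fun w => Subsingleton.elim (e₀ 1 w) (e₀ 0 w)))
  obtain ⟨W, _, _, _, _, π, q, hπ, hψ, hq, H⟩ := exists_reduction hann xs hmem ω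
    ⟨LinearMap.id, Function.surjective_id, fun ψ => by
      obtain ⟨r, hr⟩ := hω.1.2.1.2 ψ
      exact ⟨r, by rw [← hr]; rfl⟩⟩
    (fun i hi => hω.1.extVan hi) (e₀.isWeaklyRegular_congr xs |>.mp hreg.toIsWeaklyRegular)
  have hkill {M : Type u} [AddCommGroup M] [Module R M] (hM : ∀ x ∈ xs, ∀ m : M, x • m = 0) :
      maximalIdeal R ^ n ≤ Module.annihilator R M := by
    refine hn.trans (Ideal.span_le.mpr fun x hx => Module.mem_annihilator.mpr ?_)
    exact hM x hx
  have hres : ∀ x ∈ xs, ∀ m : R ⧸ maximalIdeal R, x • m = 0 := by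
    intro x hx m
    obtain ⟨r, rfl⟩ := Ideal.Quotient.mk_surjective m
    exact Ideal.Quotient.eq_zero_iff_mem.mpr (Ideal.mul_mem_right _ _ (hmem x hx))
  have hHom : ∀ x ∈ xs, ∀ m : ω →ₗ[R] W, x • m = 0 := fun x hx m =>
    LinearMap.ext fun w => H.smul_eq_zero x hx (m w)
  have : Nontrivial (ω →ₗ[R] W) := by
    refine ⟨π, 0, fun h => ?_⟩
    obtain ⟨w, hw⟩ := exists_ne (0 : W)
    obtain ⟨v, rfl⟩ := hπ w
    exact hw (by rw [h]; rfl)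
  obtain ⟨j, hj⟩ := exists_injective_residue (hkill hHom)
  have hvanHom : ∀ i, xs.length < i → ExtVan R (ω →ₗ[R] W) ω i := by
    intro i hi
    refine H.bound ω 0 (fun i hi => ?_) i (by lia)
    have : Module.Projective R (ω →ₗ[R] ω) := .of_equiv e₀
    exact .of_proj hi
  obtain ⟨N, hN⟩ := hω.2.exists_extVan
  have hvan : ∀ k i : ℕ, N < i + k → xs.length < i → ∀ (M : Type u) [AddCommGroup M] [Module R M]
      [Module.Finite R M], maximalIdeal R ^ n ≤ Module.annihilator R M → ExtVan R M ω i := by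
    intro k
    induction k with
    | zero => exact fun i hi _ M _ _ _ _ => hN M i hi
    | succ k ih =>
      intro i hi hi' M _ _ _ hM
      refine ExtVan.of_residue ?_ M hM
      exact SES.van_first_left ⟨hj, Submodule.mkQ_surjective _, LinearMap.exact_map_mkQ_range j⟩
        (hvanHom i hi') (ih (i + 1) (by lia) (by lia) _ ((hkill hHom).trans
          (LinearMap.annihilator_le_of_surjective _ (Submodule.mkQ_surjective _))))
  obtain ⟨φ, hφ⟩ := exists_injective_residue (hkill H.smul_eq_zero)
  have hext : ∀ ψ : (R ⧸ maximalIdeal R) →ₗ[R] W, ∃ e : W →ₗ[R] W, e ∘ₗ φ = ψ := by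
    refine H.extend _ _ H.smul_eq_zero hres φ fun z => ?_
    have hs : SES φ (LinearMap.range φ).mkQ :=
      ⟨hφ, Submodule.mkQ_surjective _, LinearMap.exact_map_mkQ_range φ⟩
    exact Abelian.Ext.contravariant_sequence_exact₁ hs.shortExact _ z (add_comm 1 _)
      (extVan_iff.mp (hvan (N + 1) _ (by lia) (by lia) _ ((hkill H.smul_eq_zero).trans
          (LinearMap.annihilator_le_of_surjective _ (Submodule.mkQ_surjective _)))) _)
  have hsurj : Function.Surjective
      (LinearMap.toSpanSingleton R ((R ⧸ maximalIdeal R) →ₗ[R] W) φ) := by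
    intro ψ
    obtain ⟨e, rfl⟩ := hext ψ
    obtain ⟨r, hr⟩ := hψ (e ∘ₗ π)
    refine ⟨r, LinearMap.ext fun c => ?_⟩
    obtain ⟨w, hw⟩ := hπ (φ c)
    have := LinearMap.congr_fun hr w
    simp only [LinearMap.comp_apply, LinearMap.smul_apply, hw] at this
    simp [this]
  have hker : LinearMap.ker (LinearMap.toSpanSingleton R ((R ⧸ maximalIdeal R) →ₗ[R] W) φ) =
      maximalIdeal R := by
    ext r
    have h1 : r • (1 : R ⧸ maximalIdeal R) = 0 ↔ r ∈ maximalIdeal R := by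
      rw [Algebra.smul_def, mul_one]
      exact Ideal.Quotient.eq_zero_iff_mem
    rw [LinearMap.mem_ker, LinearMap.toSpanSingleton_apply, ← h1]
    refine ⟨fun h => hφ ?_, fun h => LinearMap.ext fun c => ?_⟩
    · rw [map_smul, map_zero]
      exact LinearMap.congr_fun h 1
    · have : r • c = 0 := by
        rw [← mul_one c, ← mul_smul_comm, h, mul_zero]
      rw [LinearMap.smul_apply, ← map_smul, this, map_zero, LinearMap.zero_apply]
  obtain ⟨e⟩ := H.equiv (R ⧸ maximalIdeal R) hres
  have e₁ : ((R ⧸ maximalIdeal R) →ₗ[R] (ω →ₗ[R] W)) ≃ₗ[R]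
      (ω →ₗ[R] ((R ⧸ maximalIdeal R) →ₗ[R] W)) := LinearMap.lflip
  have e₂ := (Submodule.quotEquivOfEq _ _ hker).symm.trans
    (LinearMap.quotKerEquivOfSurjective _ hsurj)
  have e₃ : ExtGrp R (R ⧸ maximalIdeal R) R xs.length ≃ₗ[R]
      ExtGrp R (R ⧸ maximalIdeal R) (ω →ₗ[R] ω) xs.length :=
    (((Ext R (ModuleCat.{u} R) xs.length).obj
      (Opposite.op (ModuleCat.of R (R ⧸ maximalIdeal R)))).mapIso e₀.toModuleIso).toLinearEquiv
  exact ⟨e₃.trans <| (extComparison _ _).trans <| e.trans <| e₁.trans e₂.symm.congrRight⟩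

end TypeLemma

section Generators

open IsLocalRing TensorProduct

variable {R : Type u} [CommRing R] [IsLocalRing R] {M N : Type u} [AddCommGroup M] [Module R M]
  [AddCommGroup N] [Module R N]

lemma finrank_eq_of_dual_equiv
    (e : (M →ₗ[R] ResidueField R) ≃ₗ[R] (N →ₗ[R] ResidueField R)) :
    Module.finrank (ResidueField R) (ResidueField R ⊗[R] M) =
      Module.finrank (ResidueField R) (ResidueField R ⊗[R] N) := by
  rw [← Subspace.dual_finrank_eq, ← Subspace.dual_finrank_eq (V := ResidueField R ⊗[R] N)]
  exact LinearEquiv.finrank_eq ((LinearMap.liftBaseChangeEquiv (ResidueField R)).symm.trans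
    ((e.extendScalarsOfSurjective residue_surjective).trans
      (LinearMap.liftBaseChangeEquiv (ResidueField R))))

lemma exists_span_singleton_eq_top [Module.Finite R M]
    (h : Module.finrank (ResidueField R) (ResidueField R ⊗[R] M) = 1) :
    ∃ x : M, Submodule.span R {x} = ⊤ := by
  obtain ⟨x, hx⟩ := TensorProduct.mk_surjective R M (ResidueField R) residue_surjective
    (Module.basisUnique Unit h ())
  refine ⟨x, ?_⟩
  have := span_eq_top_of_tmul_eq_basis (fun _ : Unit => x) (Module.basisUnique Unit h)
    (fun _ => hx)
  simpa using this

lemma exists_span_singleton_hom_eq_top [IsNoetherianRing R] [Module.Finite R M] [Module.Finite R N]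
    [Nontrivial M]
    (h : Function.Bijective (evalMap R M N))
    (e : (M →ₗ[R] ResidueField R) ≃ₗ[R] (N →ₗ[R] ResidueField R)) :
    ∃ φ : M →ₗ[R] N, Submodule.span R {φ} = ⊤ := by
  refine exists_span_singleton_eq_top ?_
  have h1 := LinearEquiv.finrank_eq ((LinearEquiv.ofBijective _ h).baseChange R (ResidueField R) _ _)
  rw [← finrank_eq_of_dual_equiv e,
    (AlgebraTensorModule.distribBaseChange R (ResidueField R) M (M →ₗ[R] N)).finrank_eq,
    Module.finrank_tensorProduct] at h1
  have h2 : Nontrivial (ResidueField R ⊗[R] M) := by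
    rwa [← not_subsingleton_iff_nontrivial, subsingleton_tensorProduct,
      not_subsingleton_iff_nontrivial]
  have h3 : 0 < Module.finrank (ResidueField R) (ResidueField R ⊗[R] M) := Module.finrank_pos
  exact Nat.eq_of_mul_eq_mul_left h3 (by rw [h1, mul_one])

end Generators

section QuasiGorenstein

open IsLocalRing TensorProduct

variable {R : Type u} [CommRing R] [IsNoetherianRing R] [IsLocalRing R] {a : Ideal R}
  {ω ω' : Type u} [AddCommGroup ω] [Module R ω] [AddCommGroup ω'] [Module R ω']
  [Module (R ⧸ a) ω'] [IsScalarTower R (R ⧸ a) ω']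

omit [IsNoetherianRing R] in
lemma map_maximalIdeal_eq [IsLocalRing (R ⧸ a)] :
    (maximalIdeal R).map (Ideal.Quotient.mk a) = maximalIdeal (R ⧸ a) := by
  have ha : a ≤ maximalIdeal R := le_maximalIdeal (Ideal.Quotient.nontrivial_iff.mp inferInstance)
  refine eq_maximalIdeal ?_
  refine (Ideal.map_eq_top_or_isMaximal_of_surjective _ Ideal.Quotient.mk_surjective
    (maximalIdeal.isMaximal R)).resolve_left fun h => ?_
  have h1 := congrArg (Ideal.comap (Ideal.Quotient.mk a)) h
  rw [Ideal.comap_map_of_surjective _ Ideal.Quotient.mk_surjective, ← RingHom.ker_eq_comap_bot,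
    Ideal.mk_ker, sup_eq_left.mpr ha] at h1
  exact (maximalIdeal.isMaximal R).ne_top h1

lemma nonempty_dual_equiv (hω : IsCanonicalModule R ω)
    (hCM : (ldepth R R : WithBot ℕ∞) = ringKrullDim R) (haCM : IsCMLocalRing (R ⧸ a))
    (haQG : IsQuasiGorensteinIdeal R a) (hω' : IsCanonicalModule (R ⧸ a) ω') :
    Nonempty ((ω →ₗ[R] ResidueField R) ≃ₗ[R] (ω' →ₗ[R] ResidueField R)) := by
  obtain ⟨_, hCM'⟩ := haCM
  have hB := haQG.2 0
  rw [map_maximalIdeal_eq] at hB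
  obtain ⟨ι, ⟨e₁⟩, ⟨e₂⟩⟩ := hB
  rw [zero_add] at e₁ e₂
  obtain ⟨f₁⟩ := hω.nonempty_ext_equiv hCM
  obtain ⟨f₂⟩ := hω'.nonempty_ext_equiv hCM'
  have ha : a ≤ maximalIdeal R := le_maximalIdeal (Ideal.Quotient.nontrivial_iff.mp inferInstance)
  have g : ((R ⧸ a) ⧸ maximalIdeal (R ⧸ a)) ≃ₗ[R] R ⧸ maximalIdeal R :=
    (Submodule.quotEquivOfEq _ _ map_maximalIdeal_eq.symm).restrictScalars R ≪≫ₗ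
      (DoubleQuot.quotQuotEquivQuotOfLEₐ R ha).toLinearEquiv
  have g₂ := (f₂.symm.trans e₂).restrictScalars R
  have g₃ : (ω' →ₗ[R] ((R ⧸ a) ⧸ maximalIdeal (R ⧸ a))) ≃ₗ[R]
      (ω' →ₗ[R ⧸ a] ((R ⧸ a) ⧸ maximalIdeal (R ⧸ a))) :=
    LinearMap.extendScalarsOfSurjectiveEquiv Ideal.Quotient.mk_surjective
  exact ⟨(f₁.symm.trans e₁).trans ((Finsupp.mapRange.linearEquiv g).symm.trans
    (g₂.symm.trans (g₃.symm.trans g.congrRight)))⟩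

/-- The canonical module of the quotient by a Cohen-Macaulay quasi-Gorenstein ideal `a` is
`ω / a ω`. -/
theorem exists_surjective_ker_eq (hω : IsCanonicalModule R ω)
    (hCM : (ldepth R R : WithBot ℕ∞) = ringKrullDim R) (haCM : IsCMLocalRing (R ⧸ a))
    (haQG : IsQuasiGorensteinIdeal R a) (hω' : IsCanonicalModule (R ⧸ a) ω') :
    ∃ φ : ω →ₗ[R] ω', Function.Surjective φ ∧ LinearMap.ker φ = a • ⊤ := by
  obtain ⟨e⟩ := nonempty_dual_equiv hω hCM haCM haQG hω'
  have := hω.1.1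
  have := hω'.1.1
  have : Module.Finite R ω' := .trans (R ⧸ a) ω'
  have : Nontrivial ω := by
    by_contra h
    rw [not_nontrivial_iff_subsingleton] at h
    exact one_ne_zero (hω.1.2.1.1 (LinearMap.ext fun w =>
      Subsingleton.elim (LinearMap.lsmul R ω 1 w) (LinearMap.lsmul R ω 0 w)))
  have hbij := (hω.bassLike_canonical haQG.1 hω'.2).1
  obtain ⟨φ, hφ⟩ := exists_span_singleton_hom_eq_top hbij e
  have hgen (ψ : ω →ₗ[R] ω') : ∃ r : R, r • φ = ψ :=
    Submodule.mem_span_singleton.mp (hφ ▸ Submodule.mem_top)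
  have hsurj : Function.Surjective φ := by
    rw [← LinearMap.range_eq_top, ← top_le_iff]
    rintro y -
    obtain ⟨t, rfl⟩ := hbij.2 y
    induction t with
    | zero => simp
    | add s t hs ht => rw [map_add]; exact add_mem hs ht
    | tmul w ψ =>
      obtain ⟨r, rfl⟩ := hgen ψ
      exact ⟨r • w, by simp [evalMap]⟩
  have hsmul (r : R) (hr : r ∈ a) (y : ω') : r • y = 0 := by
    rw [← one_smul (R ⧸ a) y, ← smul_assoc, Algebra.smul_def, mul_one]
    change Ideal.Quotient.mk a r • y = 0
    rw [Ideal.Quotient.eq_zero_iff_mem.mpr hr, zero_smul]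
  have hker : LinearMap.ker (LinearMap.toSpanSingleton R (ω →ₗ[R] ω') φ) = a := by
    ext r
    rw [LinearMap.mem_ker, LinearMap.toSpanSingleton_apply]
    refine ⟨fun h => ?_, fun hr => LinearMap.ext fun w => hsmul r hr _⟩
    rw [← Ideal.Quotient.eq_zero_iff_mem]
    refine hω'.1.2.1.1 (LinearMap.ext fun y => ?_)
    obtain ⟨w, rfl⟩ := hsurj y
    have := LinearMap.congr_fun h w
    simpa [← Ideal.Quotient.algebraMap_eq] using this
  refine ⟨φ, hsurj, le_antisymm (fun w hw => ?_) (Submodule.smul_le.mpr fun r hr w _ => ?_)⟩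
  · have h0 : w ⊗ₜ[R] φ = 0 := hbij.1 (by simpa [evalMap] using hw)
    set e₁ : (R ⧸ a) ≃ₗ[R] (ω →ₗ[R] ω') := Submodule.quotEquivOfEq _ _ hker.symm ≪≫ₗ
      (LinearMap.toSpanSingleton R (ω →ₗ[R] ω') φ).quotKerEquivOfSurjective hgen
    have he : e₁ 1 = φ := one_smul R φ
    have h1 : w ⊗ₜ[R] (1 : R ⧸ a) = 0 := by
      apply (e₁.lTensor ω).injective
      rw [LinearEquiv.lTensor_tmul, he, h0, map_zero]
    rw [← tensorQuotEquivQuotSMul_symm_mk, LinearEquiv.map_eq_zero_iff] at h1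
    exact (Submodule.Quotient.mk_eq_zero _).mp h1
  · rw [LinearMap.mem_ker, map_smul, hsmul r hr]

end QuasiGorenstein

section Classes

open TensorProduct

variable {R : Type u} [CommRing R] {ω M N : Type u} [AddCommGroup ω] [Module R ω]
  [AddCommGroup M] [Module R M] [AddCommGroup N] [Module R N]

/-- Isomorphic modules have isomorphic `Tor` modules. -/
def torCongrLeft (e : M ≃ₗ[R] N) (X : Type u) [AddCommGroup X] [Module R X] (i : ℕ) :
    TorGrp R M X i ≃ₗ[R] TorGrp R N X i :=
  (((Tor (ModuleCat.{u} R) i).mapIso e.toModuleIso).app (ModuleCat.of R X)).toLinearEquiv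

lemma subsingleton_extGrp_congr_right (e : M ≃ₗ[R] N) {i : ℕ}
    (h : Subsingleton (ExtGrp R ω M i)) : Subsingleton (ExtGrp R ω N i) :=
  subsingleton_extGrp_iff.mpr ((subsingleton_extGrp_iff.mp h).congr_right e)

lemma MemBass.congr (h : MemBass R ω M) (e : M ≃ₗ[R] N) : MemBass R ω N :=
  ⟨evalMap_bijective_congr e h.1,
    fun i hi => have := h.2.1 i hi
      (torCongrLeft (LinearEquiv.congrRight e (M := ω)) ω i).symm.injective.subsingleton,
    fun i hi => subsingleton_extGrp_congr_right e (h.2.2 i hi)⟩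

lemma mk_bijective_congr (e : M ≃ₗ[R] N) (h : Function.Bijective (TensorProduct.mk R M ω)) :
    Function.Bijective (TensorProduct.mk R N ω) := by
  have : ⇑(TensorProduct.mk R N ω) =
      LinearEquiv.congrRight (e.rTensor ω) (M := ω) ∘ TensorProduct.mk R M ω ∘ e.symm := by
    ext n w
    change n ⊗ₜ[R] w = e.rTensor ω (e.symm n ⊗ₜ[R] w)
    simp
  rw [this]
  exact (LinearEquiv.bijective _).comp (h.comp e.symm.bijective)

lemma MemAus.congr (h : MemAus R ω M) (e : M ≃ₗ[R] N) : MemAus R ω N :=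
  ⟨mk_bijective_congr e h.1,
    fun i hi => have := h.2.1 i hi
      (torCongrLeft e ω i).symm.injective.subsingleton,
    fun i hi => subsingleton_extGrp_congr_right (e.rTensor ω) (h.2.2 i hi)⟩

lemma MemAus.memBass_tensorProduct (h : MemAus R ω M) : MemBass R ω (M ⊗[R] ω) := by
  set γ := LinearEquiv.ofBijective _ h.1
  refine ⟨?_, fun i hi => ?_, h.2.2⟩
  · have h1 : evalMap R ω (M ⊗[R] ω) ∘ₗ (γ.lTensor ω).toLinearMap =
        (TensorProduct.comm R ω M).toLinearMap := by
      ext w m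
      simp [evalMap, γ]
    have h2 : ⇑(evalMap R ω (M ⊗[R] ω)) ∘ γ.lTensor ω = TensorProduct.comm R ω M :=
      congrArg DFunLike.coe h1
    refine (Function.Bijective.of_comp_iff _ (γ.lTensor ω).bijective).mp ?_
    rw [h2]
    exact (TensorProduct.comm R ω M).bijective
  · have := h.2.1 i hi
    exact (torCongrLeft γ ω i).symm.injective.subsingleton

lemma MemBass.memAus_hom (h : MemBass R ω N) : MemAus R ω (ω →ₗ[R] N) := by
  set ε := (TensorProduct.comm R (ω →ₗ[R] N) ω) ≪≫ₗ LinearEquiv.ofBijective _ h.1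
  refine ⟨?_, h.2.1, fun i hi => subsingleton_extGrp_congr_right ε.symm (h.2.2 i hi)⟩
  have h1 : ⇑(LinearEquiv.congrRight ε (M := ω)) ∘ TensorProduct.mk R (ω →ₗ[R] N) ω = id := by
    ext f w
    rfl
  refine (Function.Bijective.of_comp_iff' (LinearEquiv.congrRight ε (M := ω)).bijective _).mp ?_
  rw [h1]
  exact Function.bijective_id

end Classes

section Linkage

open TensorProduct

variable {A : Type u} [CommRing A] {C M N : Type u} [AddCommGroup C] [Module A C]
  [AddCommGroup M] [Module A M] [AddCommGroup N] [Module A N]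

/-- Transport of a minimal presentation along an isomorphism. -/
def MinPres.congr (pres : MinPres A M) (e : M ≃ₗ[A] N) : MinPres A N where
  P₁ := pres.P₁
  P₀ := pres.P₀
  f := pres.f
  g := e.toLinearMap ∘ₗ pres.g
  finite₁ := pres.finite₁
  finite₀ := pres.finite₀
  proj₁ := pres.proj₁
  proj₀ := pres.proj₀
  surj := e.surjective.comp pres.surj
  exact := by rw [LinearEquiv.ker_comp, pres.exact]
  min₀ := by rw [LinearEquiv.ker_comp]; exact pres.min₀
  min₁ := pres.min₁

lemma IsOmegaTrC.congr_left {X : Type u} [AddCommGroup X] [Module A X]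
    (h : IsOmegaTrC A C M X) (e : M ≃ₗ[A] N) : IsOmegaTrC A C N X := by
  obtain ⟨pres, he⟩ := h
  exact ⟨pres.congr e, he⟩

lemma homC_dualTensorHom (pres : MinPres A M) (t : Module.Dual A pres.P₀ ⊗[A] C) :
    pres.homC C (dualTensorHom A pres.P₀ C t) =
      dualTensorHom A pres.P₁ C ((pres.homC A).rTensor C t) := by
  induction t with
  | zero => simp
  | add s t hs ht => simp only [map_add, hs, ht]
  | tmul g c =>
    ext p
    simp [MinPres.homC]

theorem isOmegaTrC_tensorProduct [IsNoetherianRing A] [Module.Finite A C]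
    (hC : Module.annihilator A C = ⊥) (hM : Function.Bijective (TensorProduct.mk A M C))
    (h : IsOmegaTrC A A M M) : IsOmegaTrC A C (C →ₗ[A] M ⊗[A] C) (M ⊗[A] C) := by
  refine IsOmegaTrC.congr_left ?_ (LinearEquiv.ofBijective _ hM)
  obtain ⟨pres, ⟨e⟩⟩ := h
  have := pres.finite₁
  have := pres.finite₀
  have := pres.proj₁
  have := pres.proj₀
  set ι : M →ₗ[A] Module.Dual A pres.P₁ := (LinearMap.range (pres.homC A)).subtype ∘ₗ e.toLinearMap
  set p : Module.Dual A pres.P₀ →ₗ[A] M := e.symm.toLinearMap ∘ₗ (pres.homC A).rangeRestrict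
  have hp : Function.Surjective p :=
    e.symm.surjective.comp (pres.homC A).surjective_rangeRestrict
  have hι : Function.Injective ι := (Submodule.injective_subtype _).comp e.injective
  have hιp : ι ∘ₗ p = pres.homC A := by
    ext1 g
    simp [ι, p]
  set ψ : M ⊗[A] C →ₗ[A] (pres.P₁ →ₗ[A] C) := dualTensorHom A pres.P₁ C ∘ₗ ι.rTensor C
  have hψp (t) : ψ (p.rTensor C t) = pres.homC C (dualTensorHom A pres.P₀ C t) := by
    rw [homC_dualTensorHom, ← hιp, LinearMap.rTensor_comp C ι p]
    rfl
  have hrange : LinearMap.range ψ = LinearMap.range (pres.homC C) := by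
    refine le_antisymm ?_ ?_
    · rintro _ ⟨t, rfl⟩
      obtain ⟨s, rfl⟩ := LinearMap.rTensor_surjective C hp t
      exact ⟨_, (hψp s).symm⟩
    · rintro _ ⟨g, rfl⟩
      obtain ⟨s, rfl⟩ := (dualTensorHom_bijective (R := A) (M := pres.P₀) (N := C)).2 g
      exact ⟨_, hψp s⟩
  have hinj : Function.Injective ψ := by
    have : Subsingleton (LinearMap.ker ψ) := by
      refine subsingleton_of_hom_eq_zero hC fun f => ?_
      obtain ⟨m, hm⟩ := hM.2 ((LinearMap.ker ψ).subtype ∘ₗ f)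
      have hm0 : ι m = 0 := by
        ext x
        have : ι m x ∈ Module.annihilator A C := by
          rw [Module.mem_annihilator]
          intro c
          have h1 : m ⊗ₜ[A] c = f c := LinearMap.congr_fun hm c
          have h2 : ψ (m ⊗ₜ[A] c) = 0 := h1 ▸ (f c).2
          simpa [ψ] using LinearMap.congr_fun h2 x
        rwa [hC, Ideal.mem_bot] at this
      rw [hι (hm0.trans (map_zero ι).symm), map_zero] at hm
      ext c
      exact (LinearMap.congr_fun hm c).symm
    exact LinearMap.ker_eq_bot.mp (Submodule.subsingleton_iff_eq_bot.mp this)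
  exact ⟨pres, ⟨LinearEquiv.ofInjective ψ hinj ≪≫ₗ LinearEquiv.ofEq _ _ hrange⟩⟩

theorem isOmegaTrC_hom [IsNoetherianRing A] [Module.Finite A C]
    (hann : Module.annihilator A C = ⊥) (hC : Function.Bijective (LinearMap.lsmul A C))
    (hN : Function.Bijective (evalMap A C N))
    (h : IsOmegaTrC A C (C →ₗ[A] N) N) : IsOmegaTrC A A (C →ₗ[A] N) (C →ₗ[A] N) := by
  obtain ⟨pres, ⟨e⟩⟩ := h
  have := pres.finite₀
  have := pres.proj₀
  set ι : N →ₗ[A] (pres.P₁ →ₗ[A] C) :=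
    (LinearMap.range (pres.homC C)).subtype ∘ₗ e.toLinearMap
  set q : (pres.P₀ →ₗ[A] C) →ₗ[A] N := e.symm.toLinearMap ∘ₗ (pres.homC C).rangeRestrict
  have hq : Function.Surjective q :=
    e.symm.surjective.comp (pres.homC C).surjective_rangeRestrict
  have hι : Function.Injective ι := (Submodule.injective_subtype _).comp e.injective
  have hιq (g) : ι (q g) = pres.homC C g := by simp [ι, q]
  set J : (C →ₗ[A] N) →ₗ[A] (pres.P₁ →ₗ[A] A) :=
    (homSemiEquiv hC pres.P₁).symm.toLinearMap ∘ₗ ι.compRight A (M := C)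
  set ρ : (pres.P₀ →ₗ[A] A) →ₗ[A] (C →ₗ[A] N) :=
    q.compRight A (M := C) ∘ₗ (homSemiEquiv hC pres.P₀).toLinearMap
  have hJ : Function.Injective J := (homSemiEquiv hC pres.P₁).symm.injective.comp
    fun s t hst => LinearMap.ext fun c => hι (LinearMap.congr_fun hst c)
  have hJρ (g) : J (ρ g) = pres.homC A g := by
    refine (LinearEquiv.symm_apply_eq _).mpr ?_
    ext c x
    simp [ρ, hιq, MinPres.homC]
  have hρ : Function.Surjective ρ := by
    have : Subsingleton ((C →ₗ[A] N) ⧸ LinearMap.range ρ) := by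
      refine subsingleton_of_subsingleton_tensorProduct hann fun t => ?_
      obtain ⟨t, rfl⟩ := LinearMap.lTensor_surjective C (LinearMap.range ρ).mkQ_surjective t
      obtain ⟨g, hg⟩ := hq (evalMap A C N t)
      obtain ⟨s, rfl⟩ := (dualTensorHom_bijective (R := A) (M := pres.P₀) (N := C)).2 g
      have hs : evalMap A C N (ρ.lTensor C (TensorProduct.comm A _ C s)) =
          q (dualTensorHom A pres.P₀ C s) := by
        clear hg
        induction s with
        | zero => simp
        | add x y hx hy => simp only [map_add, hx, hy]
        | tmul g c =>
          have : homSemiEquiv hC pres.P₀ g c = dualTensorHom A pres.P₀ C (g ⊗ₜ c) := by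
            ext x
            simp
          simp only [TensorProduct.comm_tmul, LinearMap.lTensor_tmul, ← this]
          rfl
      rw [← hN.1 (hs.trans hg), ← LinearMap.comp_apply, ← LinearMap.lTensor_comp,
        LinearMap.range_mkQ_comp]
      simp
    exact LinearMap.range_eq_top.mp (Submodule.Quotient.subsingleton_iff.mp this)
  have hrange : LinearMap.range J = LinearMap.range (pres.homC A) := by
    refine le_antisymm ?_ ?_
    · rintro _ ⟨t, rfl⟩
      obtain ⟨g, rfl⟩ := hρ t
      exact ⟨g, (hJρ g).symm⟩
    · rintro _ ⟨g, rfl⟩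
      exact ⟨ρ g, hJρ g⟩
  exact ⟨pres, ⟨LinearEquiv.ofInjective J hJ ≪≫ₗ LinearEquiv.ofEq _ _ hrange⟩⟩

end Linkage

section Transfer

open TensorProduct

variable {R : Type u} [CommRing R] {a : Ideal R} {ω ω' M : Type u} [AddCommGroup ω] [Module R ω]
  [AddCommGroup ω'] [Module R ω'] [Module (R ⧸ a) ω'] [IsScalarTower R (R ⧸ a) ω']
  [AddCommGroup M] [Module R M] [Module (R ⧸ a) M] [IsScalarTower R (R ⧸ a) M]
  (φ : ω →ₗ[R] ω')

lemma smul_eq_zero_of_mem {r : R} (hr : r ∈ a) (m : M) : r • m = 0 := by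
  rw [← algebraMap_smul (R ⧸ a) r m, Ideal.Quotient.algebraMap_eq,
    Ideal.Quotient.eq_zero_iff_mem.mpr hr, zero_smul]

variable (a M) in
/-- The map `M ⊗_R ω → M ⊗_{R/a} ω'` induced by `φ : ω → ω'`. -/
def tensorMapQuotient : M ⊗[R] ω →ₗ[R] M ⊗[R ⧸ a] ω' :=
  TensorProduct.lift
    { toFun := fun m => ((TensorProduct.mk (R ⧸ a) M ω' m).restrictScalars R) ∘ₗ φ
      map_add' := fun m n => by ext w; simp
      map_smul' := fun r m => by ext w; simp [smul_tmul'] }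

@[simp]
lemma tensorMapQuotient_tmul (m : M) (w : ω) :
    tensorMapQuotient a M φ (m ⊗ₜ w) = m ⊗ₜ φ w :=
  rfl

variable (a M) in
/-- The map `Hom_{R/a}(ω', M) → Hom_R(ω, M)` induced by `φ : ω → ω'`. -/
def homMapQuotient : (ω' →ₗ[R ⧸ a] M) →ₗ[R] (ω →ₗ[R] M) where
  toFun f := f.restrictScalars R ∘ₗ φ
  map_add' _ _ := rfl
  map_smul' _ _ := rfl

@[simp]
lemma homMapQuotient_apply (f : ω' →ₗ[R ⧸ a] M) (w : ω) :
    homMapQuotient a M φ f w = f (φ w) :=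
  rfl

variable {φ} (hφ : Function.Surjective φ) (hker : LinearMap.ker φ = a • ⊤)
include hφ hker

lemma tensorMapQuotient_bijective : Function.Bijective (tensorMapQuotient a M φ) := by
  set q : M ⊗[R] ω' →ₗ[R] M ⊗[R ⧸ a] ω' := tensorMapQuotient a M LinearMap.id
  have hq : tensorMapQuotient a M φ = q ∘ₗ φ.lTensor M := by
    ext m w
    rfl
  have : CompatibleSMul R (R ⧸ a) M ω' := ⟨fun c m w => by
    obtain ⟨r, rfl⟩ := Ideal.Quotient.mk_surjective c
    rw [← Ideal.Quotient.algebraMap_eq, algebraMap_smul, algebraMap_smul, smul_tmul]⟩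
  have hqe : q = (equivOfCompatibleSMul (R ⧸ a) R R M ω').toLinearMap := by
    ext m w
    rfl
  have hinj : Function.Injective (φ.lTensor M) := by
    refine (injective_iff_map_eq_zero _).mpr fun t ht => ?_
    obtain ⟨s, rfl⟩ := (lTensor_exact M (LinearMap.exact_subtype_ker_map φ) hφ t).mp ht
    clear ht
    induction s with
    | zero => exact map_zero _
    | add x y hx hy => rw [map_add, hx, hy, add_zero]
    | tmul m w =>
      obtain ⟨w, hw⟩ := w
      rw [LinearMap.lTensor_tmul]
      change m ⊗ₜ[R] w = 0
      rw [hker] at hw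
      induction hw using Submodule.smul_induction_on' with
      | smul r hr w _ => rw [← smul_tmul, smul_eq_zero_of_mem hr, zero_tmul]
      | add x _ y _ hx hy => rw [tmul_add, hx, hy, add_zero]
  rw [hq, hqe]
  exact (equivOfCompatibleSMul (R ⧸ a) R R M ω').bijective.comp
    ⟨hinj, LinearMap.lTensor_surjective M hφ⟩

lemma homMapQuotient_bijective : Function.Bijective (homMapQuotient a M φ) := by
  refine ⟨fun f g h => LinearMap.ext fun y => ?_, fun f => ?_⟩
  · obtain ⟨w, rfl⟩ := hφ y
    exact LinearMap.congr_fun h w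
  · have hf : f ∘ₗ (LinearMap.ker φ).subtype = 0 := by
      ext ⟨w, hw⟩
      change f w = 0
      rw [hker] at hw
      induction hw using Submodule.smul_induction_on' with
      | smul r hr w _ => rw [map_smul, smul_eq_zero_of_mem hr]
      | add x _ y _ hx hy => rw [map_add, hx, hy, add_zero]
    obtain ⟨g, rfl⟩ := (SES.ker_subtype hφ).exists_desc f hf
    exact ⟨extendQuotient g, rfl⟩

lemma mk_bijective_quotient (h : Function.Bijective (TensorProduct.mk R M ω)) :
    Function.Bijective (TensorProduct.mk (R ⧸ a) M ω') := by
  set T := LinearEquiv.ofBijective _ (tensorMapQuotient_bijective (M := M) hφ hker)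
  have h1 : ⇑(homMapQuotient a (M ⊗[R ⧸ a] ω') φ) ∘ TensorProduct.mk (R ⧸ a) M ω' =
      LinearEquiv.congrRight T (M := ω) ∘ TensorProduct.mk R M ω := by
    ext m w
    rfl
  refine (Function.Bijective.of_comp_iff' (homMapQuotient_bijective hφ hker) _).mp ?_
  rw [h1]
  exact (LinearEquiv.bijective _).comp h

lemma evalMap_bijective_quotient (h : Function.Bijective (evalMap R ω M)) :
    Function.Bijective (evalMap (R ⧸ a) ω' M) := by
  set H := LinearEquiv.ofBijective _ (homMapQuotient_bijective (M := M) hφ hker)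
  set T := LinearEquiv.ofBijective _
    (tensorMapQuotient_bijective (M := ω' →ₗ[R ⧸ a] M) hφ hker)
  have h1 : ⇑(evalMap (R ⧸ a) ω' M) ∘ TensorProduct.comm (R ⧸ a) _ ω' ∘ T =
      evalMap R ω M ∘ TensorProduct.comm R _ ω ∘ H.rTensor ω := by
    ext t
    induction t with
    | zero => simp
    | add x y hx hy => simpa using congrArg₂ (· + ·) hx hy
    | tmul f w => rfl
  refine (Function.Bijective.of_comp_iff _
    ((TensorProduct.comm (R ⧸ a) _ ω').bijective.comp T.bijective)).mp ?_
  rw [h1]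
  exact h.comp ((TensorProduct.comm R _ ω).bijective.comp (H.rTensor ω).bijective)

end Transfer
end Paper

open Paper in
/-- Theorem 3.15: the adjoint equivalence between modules in the
Auslander class self-linked by the ideal `a` and modules in the Bass class
self-linked by `a` with respect to `ω_{R̄}`. -/
theorem stmt_8 (R : Type u) [CommRing R] [IsNoetherianRing R] [IsLocalRing R]
    (hCM : (ldepth R R : WithBot ℕ∞) = ringKrullDim R)
    (ω : Type u) [AddCommGroup ω] [Module R ω] (hω : IsCanonicalModule R ω)
    (a : Ideal R) (haCM : IsCMLocalRing (R ⧸ a)) (haQG : IsQuasiGorensteinIdeal R a)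
    (ω' : Type u) [AddCommGroup ω'] [Module (R ⧸ a) ω']
    (hω' : IsCanonicalModule (R ⧸ a) ω') :
    -- (1)
    (∀ (M : Type u) [AddCommGroup M] [Module R M] [Module (R ⧸ a) M]
      [IsScalarTower R (R ⧸ a) M] [Module.Finite R M],
      MemAus R ω M → IsOmegaTrC (R ⧸ a) (R ⧸ a) M M →
        MemBass R ω (TensorProduct (R ⧸ a) M ω') ∧
        IsLambdaOf (R ⧸ a) ω' (TensorProduct (R ⧸ a) M ω') (TensorProduct (R ⧸ a) M ω') ∧
        Nonempty ((ω' →ₗ[R ⧸ a] TensorProduct (R ⧸ a) M ω') ≃ₗ[R ⧸ a] M)) ∧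
    -- (2)
    (∀ (N : Type u) [AddCommGroup N] [Module R N] [Module (R ⧸ a) N]
      [IsScalarTower R (R ⧸ a) N] [Module.Finite R N],
      MemBass R ω N → IsLambdaOf (R ⧸ a) ω' N N →
        MemAus R ω (ω' →ₗ[R ⧸ a] N) ∧
        IsOmegaTrC (R ⧸ a) (R ⧸ a) (ω' →ₗ[R ⧸ a] N) (ω' →ₗ[R ⧸ a] N) ∧
        Nonempty (TensorProduct (R ⧸ a) (ω' →ₗ[R ⧸ a] N) ω' ≃ₗ[R ⧸ a] N)) := by
  let _ : Module R ω' := Module.compHom ω' (algebraMap R (R ⧸ a))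
  have : IsScalarTower R (R ⧸ a) ω' := .of_algebraMap_smul fun _ _ => rfl
  obtain ⟨φ, hφ, hker⟩ := exists_surjective_ker_eq hω hCM haCM haQG hω'
  have := hω'.1.1
  have hann := hω'.1.annihilator_eq_bot
  refine ⟨fun M _ _ _ _ _ hM hl => ?_, fun N _ _ _ _ _ hN hl => ?_⟩
  · have hmk := mk_bijective_quotient hφ hker hM.1
    exact ⟨hM.memBass_tensorProduct.congr
        (.ofBijective _ (tensorMapQuotient_bijective hφ hker)),
      isOmegaTrC_tensorProduct hann hmk hl, ⟨(LinearEquiv.ofBijective _ hmk).symm⟩⟩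
  · have hev := evalMap_bijective_quotient hφ hker hN.1
    exact ⟨hN.memAus_hom.congr (LinearEquiv.ofBijective _ (homMapQuotient_bijective hφ hker)).symm,
      isOmegaTrC_hom hann hω'.1.2.1 hev hl,
      ⟨TensorProduct.comm _ _ _ ≪≫ₗ LinearEquiv.ofBijective _ hev⟩⟩
end
end

section
/- Let R be a commutative Noetherian semiperfect ring and C a semidualizing R-module. If a finitely generated R-module M is a C-syzygy, then Ext^1_R(Tr_C(Hom_R(C,M)), C) = 0. In particular, this vanishing holds whenever M is horizontally linked with respect to C. -/
/- Preliminary definitions for formalizing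
   "Linkage of modules with respect to a semidualizing module"
   (Dibaei–Sadeghi). -/

open CategoryTheory

universe u
noncomputable section
namespace Paper

section

variable {R : Type u} [CommRing R]

lemma subsingleton_ext_one_iff {M N : Type u} [AddCommGroup M] [Module R M] [AddCommGroup N]
    [Module R N] (P : ProjectiveResolution (ModuleCat.of R M)) :
    Subsingleton (ExtGrp R M N 1) ↔
      ∀ φ : P.complex.X 1 →ₗ[R] N, φ ∘ₗ (P.complex.d 2 1).hom = 0 →
        ∃ ψ : P.complex.X 0 →ₗ[R] N, ψ ∘ₗ (P.complex.d 1 0).hom = φ := by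
  rw [← ModuleCat.isZero_iff_subsingleton, (P.isoExt 1 (ModuleCat.of R N)).isZero_iff,
    ← HomologicalComplex.exactAt_iff_isZero_homology,
    HomologicalComplex.exactAt_iff' _ 0 1 2 (by simp) (by simp),
    ShortComplex.moduleCat_exact_iff]
  constructor
  · intro h φ hφ
    obtain ⟨ψ, hψ⟩ := h (ModuleCat.ofHom φ) (by
      apply ModuleCat.hom_ext
      exact hφ)
    exact ⟨ModuleCat.Hom.hom ψ, congrArg ModuleCat.Hom.hom hψ⟩
  · intro h φ hφ
    obtain ⟨ψ, hψ⟩ := h (ModuleCat.Hom.hom φ) (congrArg ModuleCat.Hom.hom hφ)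
    exact ⟨ModuleCat.ofHom ψ, ModuleCat.hom_ext hψ⟩

variable (R) in
/-- Every map out of `M` lifts along every extension with kernel `N`; this is the elementary form
of `Ext¹(M, N) = 0`. -/
def LiftsAlongExtensions (M N : Type u) [AddCommGroup M] [Module R M] [AddCommGroup N]
    [Module R N] : Prop :=
  ∀ (E M' : ModuleCat.{u} R) (i : N →ₗ[R] E) (π : (E : Type u) →ₗ[R] M'),
    Function.Injective i → Function.Exact i π → Function.Surjective π →
      ∀ f : M →ₗ[R] M', ∃ g : M →ₗ[R] E, π ∘ₗ g = f

lemma LiftsAlongExtensions.of_surjective {A T N : Type u} [AddCommGroup A] [Module R A]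
    [AddCommGroup T] [Module R T] [AddCommGroup N] [Module R N]
    (hA : LiftsAlongExtensions R A N) (p : A →ₗ[R] T) (hp : Function.Surjective p)
    (hext : ∀ φ : LinearMap.ker p →ₗ[R] N,
      ∃ ψ : A →ₗ[R] N, ψ ∘ₗ (LinearMap.ker p).subtype = φ) :
    LiftsAlongExtensions R T N := by
  intro E M' i π hi hex hπ f
  obtain ⟨s, hs⟩ := hA E M' i π hi hex hπ (f ∘ₗ p)
  have hs' (a : A) : π (s a) = f (p a) := LinearMap.congr_fun hs a
  have hmem (a : LinearMap.ker p) : s a ∈ LinearMap.range i :=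
    (hex _).1 (by rw [hs', LinearMap.mem_ker.1 a.2, map_zero])
  let e := LinearEquiv.ofInjective i hi
  obtain ⟨ψ, hψ⟩ := hext (e.symm.toLinearMap ∘ₗ
    LinearMap.codRestrict (LinearMap.range i) (s ∘ₗ (LinearMap.ker p).subtype) hmem)
  have hker : LinearMap.ker p ≤ LinearMap.ker (s - i ∘ₗ ψ) := by
    intro a ha
    have h1 : ψ a = e.symm ⟨s a, hmem ⟨a, ha⟩⟩ := LinearMap.congr_fun hψ ⟨a, ha⟩
    have h2 : i (ψ a) = s a := by
      rw [h1]
      exact congrArg Subtype.val (e.apply_symm_apply ⟨s a, hmem ⟨a, ha⟩⟩)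
    simp [h2]
  refine ⟨(LinearMap.ker p).liftQ (s - i ∘ₗ ψ) hker ∘ₗ
    (p.quotKerEquivOfSurjective hp).symm.toLinearMap, ?_⟩
  ext t
  obtain ⟨a, rfl⟩ := hp t
  have h3 : (p.quotKerEquivOfSurjective hp).symm (p a) = Submodule.Quotient.mk a := by
    rw [LinearEquiv.symm_apply_eq]
    rfl
  simp [h3, hs', hex.apply_apply_eq_zero]

lemma liftsAlongExtensions_of_projective {P N : Type u} [AddCommGroup P] [Module R P]
    [Module.Projective R P] [AddCommGroup N] [Module R N] : LiftsAlongExtensions R P N :=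
  fun _ _ _ π _ _ hπ f ↦ Module.projective_lifting_property π f hπ

lemma projectiveResolution_exact {M : Type u} [AddCommGroup M] [Module R M]
    (P : ProjectiveResolution (ModuleCat.of R M)) :
    Function.Surjective (P.π.f 0).hom ∧
      LinearMap.range (P.complex.d 1 0).hom = LinearMap.ker (P.π.f 0).hom ∧
      LinearMap.range (P.complex.d 2 1).hom = LinearMap.ker (P.complex.d 1 0).hom :=
  ⟨(ModuleCat.epi_iff_surjective _).1 inferInstance, P.exact₀.moduleCat_range_eq_ker,
    (P.exact_succ 0).moduleCat_range_eq_ker⟩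

lemma subsingleton_ext_one_iff_liftsAlongExtensions {M N : Type u} [AddCommGroup M] [Module R M]
    [AddCommGroup N] [Module R N] :
    Subsingleton (ExtGrp R M N 1) ↔ LiftsAlongExtensions R M N := by
  let P := projectiveResolution (ModuleCat.of R M)
  obtain ⟨hε, h₀, h₁⟩ := projectiveResolution_exact P
  let ε : P.complex.X 0 →ₗ[R] M := (P.π.f 0).hom
  let d : P.complex.X 1 →ₗ[R] P.complex.X 0 := (P.complex.d 1 0).hom
  change Function.Surjective ε at hε
  change LinearMap.range d = LinearMap.ker ε at h₀
  change _ = LinearMap.ker d at h₁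
  rw [subsingleton_ext_one_iff P]
  change (∀ φ, _ → ∃ ψ : P.complex.X 0 →ₗ[R] N, ψ ∘ₗ d = φ) ↔ _
  constructor
  · intro h
    have hP : Module.Projective R (P.complex.X 0) :=
      (IsProjective.iff_projective (R := R) (P.complex.X 0)).2 (P.projective 0)
    refine liftsAlongExtensions_of_projective.of_surjective ε hε fun φ ↦ ?_
    have hmem (x : P.complex.X 1) : d x ∈ LinearMap.ker ε := h₀ ▸ LinearMap.mem_range_self d x
    obtain ⟨ψ, hψ⟩ := h (φ ∘ₗ d.codRestrict _ hmem) (by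
      ext x
      have hx : d ((P.complex.d 2 1).hom x) = 0 :=
        LinearMap.mem_ker.1 (h₁ ▸ LinearMap.mem_range_self _ x)
      have : d.codRestrict _ hmem ((P.complex.d 2 1).hom x) = 0 := Subtype.ext hx
      simp [this])
    refine ⟨ψ, ?_⟩
    ext ⟨y, hy⟩
    obtain ⟨x, rfl⟩ := h₀.symm ▸ hy
    exact LinearMap.congr_fun hψ x
  · intro h φ hφ
    let K := LinearMap.range (d.prod (-φ))
    let i : N →ₗ[R] (P.complex.X 0 × N) ⧸ K := K.mkQ ∘ₗ LinearMap.inr R _ _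
    have hK : K ≤ LinearMap.ker (ε ∘ₗ LinearMap.fst R (P.complex.X 0) N) := by
      rintro _ ⟨x, rfl⟩
      have : d x ∈ LinearMap.ker ε := h₀ ▸ LinearMap.mem_range_self d x
      simpa using this
    let π := K.liftQ _ hK
    have hφ' (x) (hx : d x = 0) : φ x = 0 := by
      obtain ⟨y, rfl⟩ : x ∈ LinearMap.range (P.complex.d 2 1).hom := h₁ ▸ hx
      exact LinearMap.congr_fun hφ y
    have hi : Function.Injective i := by
      rw [injective_iff_map_eq_zero]
      intro n hn
      obtain ⟨x, hx⟩ := (Submodule.Quotient.mk_eq_zero K).1 hn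
      have h1 : d x = 0 := congrArg Prod.fst hx
      have h2 : -φ x = n := congrArg Prod.snd hx
      rw [← h2, hφ' x h1, neg_zero]
    have hπ : Function.Surjective π := by
      intro m
      obtain ⟨x, rfl⟩ := hε m
      exact ⟨K.mkQ (x, 0), rfl⟩
    have hex : Function.Exact i π := by
      intro z
      constructor
      · obtain ⟨⟨x, n⟩, rfl⟩ := K.mkQ_surjective z
        intro hz
        obtain ⟨y, rfl⟩ : x ∈ LinearMap.range d := h₀ ▸ hz
        refine ⟨n + φ y, ((Submodule.Quotient.eq K).2 ⟨-y, ?_⟩)⟩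
        ext <;> simp
      · rintro ⟨n, rfl⟩
        exact map_zero ε
    obtain ⟨s, hs⟩ := h (ModuleCat.of R ((P.complex.X 0 × N) ⧸ K)) (ModuleCat.of R M) i π hi hex hπ
      LinearMap.id
    have hmem (x : P.complex.X 0) :
        (K.mkQ ∘ₗ LinearMap.inl R _ _ - s ∘ₗ ε) x ∈ LinearMap.range i := by
      refine (hex _).1 ?_
      have : π (s (ε x)) = ε x := LinearMap.congr_fun hs (ε x)
      rw [LinearMap.sub_apply, map_sub]
      exact sub_eq_zero.2 this.symm
    let e := LinearEquiv.ofInjective i hi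
    refine ⟨e.symm.toLinearMap ∘ₗ LinearMap.codRestrict _ _ hmem, ?_⟩
    ext x
    change e.symm _ = _
    rw [LinearEquiv.symm_apply_eq]
    apply Subtype.ext
    have hx : ε (d x) = 0 := LinearMap.mem_ker.1 (h₀ ▸ LinearMap.mem_range_self d x)
    change K.mkQ (d x, 0) - s (ε (d x)) = K.mkQ (0, φ x)
    rw [hx, map_zero, sub_zero]
    exact (Submodule.Quotient.eq K).2 ⟨x, by ext <;> simp⟩

lemma exists_dual_basis (P : Type u) [AddCommGroup P] [Module R P] [Module.Finite R P]
    [Module.Projective R P] :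
    ∃ (n : ℕ) (x : Fin n → P) (c : Fin n → P →ₗ[R] R), ∀ p, ∑ j, c j p • x j = p := by
  obtain ⟨n, r, s, -, -, hrs⟩ := Module.Finite.exists_comp_eq_id_of_projective R P
  refine ⟨n, fun j ↦ r (Pi.single j 1), fun j ↦ LinearMap.proj j ∘ₗ s, fun p ↦ ?_⟩
  have h := LinearMap.congr_fun hrs p
  rw [LinearMap.comp_apply, ← Finset.univ_sum_single (s p), map_sum] at h
  refine Eq.trans (Finset.sum_congr rfl fun j _ ↦ ?_) h
  simp [← map_smul, ← Pi.single_smul]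

lemma sum_smulRight_dual_basis {P C : Type u} [AddCommGroup P] [Module R P] [AddCommGroup C]
    [Module R C] {n : ℕ} {x : Fin n → P} {c : Fin n → P →ₗ[R] R}
    (hxc : ∀ p, ∑ j, c j p • x j = p) (h : P →ₗ[R] C) :
    ∑ j, (c j).smulRight (h (x j)) = h := by
  ext p
  conv_rhs => rw [← hxc p]
  simp

lemma LiftsAlongExtensions.linearMap {C N P : Type u} [AddCommGroup C] [Module R C]
    [AddCommGroup N] [Module R N] [AddCommGroup P] [Module R P] [Module.Finite R P]
    [Module.Projective R P] (hC : LiftsAlongExtensions R C N) :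
    LiftsAlongExtensions R (P →ₗ[R] C) N := by
  obtain ⟨n, x, c, hxc⟩ := exists_dual_basis (R := R) P
  intro E M' i π hi hex hπ f
  choose g hg using fun j ↦ hC E M' i π hi hex hπ (f ∘ₗ LinearMap.smulRightₗ (c j))
  refine ⟨∑ j, g j ∘ₗ LinearMap.applyₗ (x j), ?_⟩
  ext h
  have hg' (j) (y : C) : π (g j y) = f ((c j).smulRight y) := LinearMap.congr_fun (hg j) y
  conv_rhs => rw [← sum_smulRight_dual_basis hxc h]
  simp [hg']

lemma bidualityMap_surjective {C P : Type u} [AddCommGroup C] [Module R C] [AddCommGroup P]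
    [Module R P] [Module.Finite R P] [Module.Projective R P]
    (hC : Function.Surjective (LinearMap.lsmul R C)) :
    Function.Surjective (bidualityMap R C P) := by
  obtain ⟨n, x, c, hxc⟩ := exists_dual_basis (R := R) P
  intro ψ
  choose a ha using fun j ↦ hC (ψ ∘ₗ LinearMap.smulRightₗ (c j))
  refine ⟨∑ j, a j • x j, ?_⟩
  ext h
  have ha' (j) (y : C) : a j • y = ψ ((c j).smulRight y) := LinearMap.congr_fun (ha j) y
  conv_rhs => rw [← sum_smulRight_dual_basis hxc h]
  simp [bidualityMap, ha']

variable (R) in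
/-- `M` is `C`-torsionless: the maps `M → C` separate the points of `M`. -/
def IsCTorsionless (C M : Type u) [AddCommGroup C] [Module R C] [AddCommGroup M]
    [Module R M] : Prop :=
  ∀ m : M, (∀ u : M →ₗ[R] C, u m = 0) → m = 0

lemma IsCTorsionless.of_injective {C M M' : Type u} [AddCommGroup C] [Module R C]
    [AddCommGroup M] [Module R M] [AddCommGroup M'] [Module R M'] (hM' : IsCTorsionless R C M')
    (i : M →ₗ[R] M') (hi : Function.Injective i) : IsCTorsionless R C M :=
  fun m hm ↦ hi <| by
    rw [map_zero]
    exact hM' _ fun u ↦ hm (u ∘ₗ i)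

lemma isCTorsionless_linearMap (C P : Type u) [AddCommGroup C] [Module R C] [AddCommGroup P]
    [Module R P] : IsCTorsionless R C (P →ₗ[R] C) :=
  fun _ hf ↦ LinearMap.ext fun p ↦ hf (LinearMap.applyₗ p)

lemma IsCTorsionless.linearMap {C M : Type u} (P : Type u) [AddCommGroup C] [Module R C]
    [AddCommGroup M] [Module R M] [AddCommGroup P] [Module R P] (hM : IsCTorsionless R C M) :
    IsCTorsionless R C (P →ₗ[R] M) :=
  fun _ hf ↦ LinearMap.ext fun p ↦ hM _ fun u ↦ hf (u ∘ₗ LinearMap.applyₗ p)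

lemma isCTorsionless_tensorProduct (C P : Type u) [AddCommGroup C] [Module R C] [AddCommGroup P]
    [Module R P] [Module.Projective R P] : IsCTorsionless R C (TensorProduct R P C) := by
  obtain ⟨s, hs⟩ := Module.projective_def'.1 (inferInstance : Module.Projective R P)
  have hinj : Function.Injective (LinearMap.rTensor C s) := by
    refine Function.LeftInverse.injective
      (g := LinearMap.rTensor C (Finsupp.linearCombination R id)) fun z ↦ ?_
    rw [← LinearMap.comp_apply, ← LinearMap.rTensor_comp, hs, LinearMap.rTensor_id,
      LinearMap.id_apply]
  classical
  let e := TensorProduct.finsuppScalarLeft R C P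
  intro z hz
  apply hinj
  apply e.injective
  ext p
  simpa using hz (Finsupp.lapply p ∘ₗ e.toLinearMap ∘ₗ LinearMap.rTensor C s)

lemma IsCSyzygy.isCTorsionless {C M : Type u} [AddCommGroup C] [Module R C] [AddCommGroup M]
    [Module R M] (h : IsCSyzygy R C M) : IsCTorsionless R C M := by
  obtain ⟨P, hP, i, hi⟩ := h
  exact (isCTorsionless_tensorProduct C P).of_injective i hi

lemma IsHorizontallyLinked.isCTorsionless {C M : Type u} [AddCommGroup C] [Module R C]
    [AddCommGroup M] [Module R M] (h : IsHorizontallyLinked R C M) : IsCTorsionless R C M := by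
  obtain ⟨N, -, pres, ⟨e⟩⟩ := h
  exact (isCTorsionless_linearMap C pres.P₁).of_injective
    ((LinearMap.range (pres.homC C)).subtype ∘ₗ e.toLinearMap)
    (Subtype.val_injective.comp e.injective)

lemma IsCTorsionless.subsingleton_ext_trC {C X : Type u} [AddCommGroup C] [Module R C]
    [AddCommGroup X] [Module R X] (hC : IsSemidualizing R C) (hX : IsCTorsionless R C X)
    (pres : MinPres R X) : Subsingleton (ExtGrp R (pres.trC C) C 1) := by
  have := pres.finite₀
  have := pres.finite₁
  have := pres.proj₀
  have := pres.proj₁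
  rw [subsingleton_ext_one_iff_liftsAlongExtensions]
  have hCC : LiftsAlongExtensions R C C :=
    subsingleton_ext_one_iff_liftsAlongExtensions.1 (hC.2.2 1 one_pos)
  let p : (pres.P₁ →ₗ[R] C) →ₗ[R] pres.trC C := (LinearMap.range (pres.homC C)).mkQ
  have hker : LinearMap.ker p = LinearMap.range (pres.homC C) := Submodule.ker_mkQ _
  refine hCC.linearMap.of_surjective p (Submodule.mkQ_surjective _) fun φ ↦ ?_
  have hmem (h : pres.P₀ →ₗ[R] C) : pres.homC C h ∈ LinearMap.ker p :=
    hker ▸ LinearMap.mem_range_self _ h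
  obtain ⟨x, hx⟩ := bidualityMap_surjective hC.2.1.2
    (φ ∘ₗ (pres.homC C).codRestrict (LinearMap.ker p) hmem)
  have hx' (h : pres.P₀ →ₗ[R] C) : h x = φ ⟨pres.homC C h, hmem h⟩ := LinearMap.congr_fun hx h
  have hgf (y : pres.P₁) : pres.g (pres.f y) = 0 :=
    LinearMap.mem_ker.1 (pres.exact ▸ LinearMap.mem_range_self pres.f y)
  have hgx : pres.g x = 0 := hX _ fun u ↦ by
    have h0 : pres.homC C (u ∘ₗ pres.g) = 0 := by
      ext y
      change u (pres.g (pres.f y)) = 0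
      rw [hgf, map_zero]
    have h1 := hx' (u ∘ₗ pres.g)
    have h2 : (⟨_, hmem (u ∘ₗ pres.g)⟩ : LinearMap.ker p) = 0 := Subtype.ext h0
    rwa [h2, map_zero] at h1
  obtain ⟨y, rfl⟩ : x ∈ LinearMap.range pres.f := pres.exact ▸ hgx
  refine ⟨LinearMap.applyₗ y, ?_⟩
  ext ⟨a, ha⟩
  obtain ⟨h, rfl⟩ : a ∈ LinearMap.range (pres.homC C) := hker ▸ ha
  exact hx' h

end

end Paper

open Paper in
/-- Lemma 4.1: if `M` is a `C`-syzygy then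
`Ext^1_R(Tr_C(Hom_R(C,M)), C) = 0`; in particular this holds when `M` is
horizontally linked with respect to `C`. -/
theorem stmt_9 (R : Type u) [CommRing R] [IsNoetherianRing R]
    (hsemiperf : IsSemiperfectRing R)
    (C : Type u) [AddCommGroup C] [Module R C] (hC : IsSemidualizing R C)
    (M : Type u) [AddCommGroup M] [Module R M] [Module.Finite R M] :
    (IsCSyzygy R C M →
      ∀ pres : MinPres R (C →ₗ[R] M), Subsingleton (ExtGrp R (pres.trC C) C 1)) ∧
    (IsHorizontallyLinked R C M →
      ∀ pres : MinPres R (C →ₗ[R] M), Subsingleton (ExtGrp R (pres.trC C) C 1)) := by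
  exact ⟨fun h ↦ (h.isCTorsionless.linearMap C).subsingleton_ext_trC hC,
    fun h ↦ (h.isCTorsionless.linearMap C).subsingleton_ext_trC hC⟩
end
end
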